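/- arXiv:2412.19230 — 2 statements merged into one kernel-verified Lean document; each statement's English description precedes it below -/
import Mathlib

section
/- Every planar graph G with maximum degree Δ and girth at least 8 satisfies χ'_ur(G) ≤ 2Δ + 2, and every planar graph with girth at least 7 satisfies χ'_ur(G) ≤ 2Δ + 4. -/
namespace SSE

open SimpleGraph

variable {V : Type*} {W : Type*}

/-- The set of vertices covered by a set of edges. -/
def cov (M : Set (Sym2 V)) : Set V := {v | ∃ e ∈ M, v ∈ e}

/-- `M` is a matching of `G`: a set of pairwise disjoint edges of `G`. -/
def IsMatchingSet (G : SimpleGraph V) (M : Set (Sym2 V)) : Prop :=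
  M ⊆ G.edgeSet ∧ ∀ e ∈ M, ∀ f ∈ M, e ≠ f → ∀ v : V, v ∈ e → v ∉ f

/-- `v` is a pendant vertex (degree 1) of the subgraph `G_M` of `G` induced by
the vertices covered by `M`. -/
def PendantIn (G : SimpleGraph V) (M : Set (Sym2 V)) (v : V) : Prop :=
  v ∈ cov M ∧ ∃! u, u ∈ cov M ∧ G.Adj v u

/-- `M` is an induced (strong) matching of `G`: every vertex of `G_M` is pendant in `G_M`. -/
def IsInducedMatching (G : SimpleGraph V) (M : Set (Sym2 V)) : Prop :=
  IsMatchingSet G M ∧ ∀ v ∈ cov M, PendantIn G M v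

/-- `M` is a semistrong matching of `G`: every edge of `M` is a pendant edge of `G_M`. -/
def IsSemistrongMatching (G : SimpleGraph V) (M : Set (Sym2 V)) : Prop :=
  IsMatchingSet G M ∧ ∀ e ∈ M, ∃ v, v ∈ e ∧ PendantIn G M v

/-- `N` is a perfect matching of the subgraph of `G` induced by `S`. -/
def IsPerfectMatchingOn (G : SimpleGraph V) (S : Set V) (N : Set (Sym2 V)) : Prop :=
  IsMatchingSet G N ∧ (∀ e ∈ N, ∀ v : V, v ∈ e → v ∈ S) ∧ cov N = S

/-- `M` is a uniquely restricted matching of `G`: it is the unique perfect matching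
of the subgraph induced by the vertices it covers. -/
def IsUniquelyRestrictedMatching (G : SimpleGraph V) (M : Set (Sym2 V)) : Prop :=
  IsMatchingSet G M ∧ ∀ N : Set (Sym2 V), IsPerfectMatchingOn G (cov M) N → N = M

/-- An edge coloring of `G` with colors `< k` each of whose color classes satisfies `P`. -/
def IsPColoring (G : SimpleGraph V) (P : SimpleGraph V → Set (Sym2 V) → Prop)
    (c : Sym2 V → ℕ) (k : ℕ) : Prop :=
  (∀ e ∈ G.edgeSet, c e < k) ∧ ∀ i : ℕ, P G {e | e ∈ G.edgeSet ∧ c e = i}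

/-- The least number of colors in an edge coloring of `G` whose color classes satisfy `P`. -/
noncomputable def pIndex (G : SimpleGraph V)
    (P : SimpleGraph V → Set (Sym2 V) → Prop) : ℕ :=
  sInf {k | ∃ c, IsPColoring G P c k}

/-- The chromatic index. -/
noncomputable def chromIndex (G : SimpleGraph V) : ℕ := pIndex G IsMatchingSet

/-- The uniquely restricted chromatic index. -/
noncomputable def urIndex (G : SimpleGraph V) : ℕ := pIndex G IsUniquelyRestrictedMatching

/-- The semistrong chromatic index. -/
noncomputable def ssIndex (G : SimpleGraph V) : ℕ := pIndex G IsSemistrongMatching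

/-- The strong chromatic index. -/
noncomputable def strongIndex (G : SimpleGraph V) : ℕ := pIndex G IsInducedMatching

/-- The degree of a vertex. -/
noncomputable def natDeg (G : SimpleGraph V) (v : V) : ℕ := (G.neighborSet v).ncard

/-- The maximum average degree of `G` is (strictly) less than `q`:
every nonempty (induced) subgraph has average degree `< q`. -/
def MadLT (G : SimpleGraph V) (q : ℚ) : Prop :=
  ∀ s : Set V, s.Finite → s.Nonempty →
    (2 * ({e ∈ G.edgeSet | ∀ v ∈ e, v ∈ s}.ncard : ℚ)) < q * s.ncard

/-- `K` is a minor of `G` (branch-set formulation). -/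
def HasMinor (G : SimpleGraph V) (K : SimpleGraph W) : Prop :=
  ∃ B : W → Set V, (∀ w, (B w).Nonempty) ∧
    (∀ w, (G.induce (B w)).Connected) ∧
    (Pairwise fun w w' => Disjoint (B w) (B w')) ∧
    (∀ w w', K.Adj w w' → ∃ u ∈ B w, ∃ v ∈ B w', G.Adj u v)

/-- `G` is planar (by Wagner's theorem: no `K₅` minor and no `K₃,₃` minor). -/
def IsPlanar (G : SimpleGraph V) : Prop :=
  ¬ HasMinor G (completeGraph (Fin 5)) ∧
  ¬ HasMinor G (completeBipartiteGraph (Fin 3) (Fin 3))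

/-- The join `C_Δ ∨ I_2` of a cycle on `Δ` vertices with an independent set of 2 vertices. -/
def joinCI (n : ℕ) : SimpleGraph (Fin n ⊕ Fin 2) :=
  SimpleGraph.fromRel (fun x y =>
    match x, y with
    | Sum.inl a, Sum.inl b => (SimpleGraph.cycleGraph n).Adj a b
    | Sum.inl _, Sum.inr _ => True
    | _, _ => False)

/-- `G` contains an `M`-alternating cycle: a cycle whose edges alternate between
edges in `M` and edges not in `M` (cyclically). -/
def HasAlternatingCycle (G : SimpleGraph V) (M : Set (Sym2 V)) : Prop :=
  ∃ (v : V) (c : G.Walk v v), c.IsCycle ∧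
    List.Chain' (fun e f => ¬(e ∈ M ↔ f ∈ M)) c.edges ∧
    ∀ e ∈ c.edges.head?, ∀ f ∈ c.edges.getLast?, ¬(e ∈ M ↔ f ∈ M)

/-- Edges `e` and `f` lie together on a cycle of length 4 in `G`. -/
def OnCommonC4 (G : SimpleGraph V) (e f : Sym2 V) : Prop :=
  ∃ (v : V) (c : G.Walk v v), c.IsCycle ∧ c.length = 4 ∧ e ∈ c.edges ∧ f ∈ c.edges


section basics
open scoped Classical
universe u
variable {V : Type u}

/-- Cut form of connectedness of a vertex set. -/
def Cn (G : SimpleGraph V) (A : Set V) : Prop :=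
  A.Nonempty ∧ ∀ P : Set V, P ⊆ A → P.Nonempty →
    (∀ a ∈ P, ∀ b ∈ A, G.Adj a b → b ∈ P) → P = A

theorem cn_connected {G : SimpleGraph V} {A : Set V} (h : Cn G A) : (G.induce A).Connected := by
  obtain ⟨⟨a, ha⟩, h⟩ := h
  have key : ∀ x : A, ∀ y : A, (G.induce A).Reachable x y := by
    intro x y
    have := h {v | ∃ hv : v ∈ A, (G.induce A).Reachable x ⟨v, hv⟩} (fun v hv => hv.1)
      ⟨x.1, x.2, Reachable.refl _⟩ (by
        rintro p ⟨hp, hr⟩ q hq hpq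
        exact ⟨hq, hr.trans (Adj.reachable (by simpa using hpq))⟩)
    have hy : y.1 ∈ {v | ∃ hv : v ∈ A, (G.induce A).Reachable x ⟨v, hv⟩} := by
      rw [this]; exact y.2
    exact hy.2
  haveI : Nonempty A := ⟨⟨a, ha⟩⟩
  exact ⟨key⟩

theorem connected_cn {G : SimpleGraph V} {A : Set V} (h : (G.induce A).Connected) : Cn G A := by
  obtain ⟨a⟩ := h.nonempty
  refine ⟨⟨a.1, a.2⟩, ?_⟩
  rintro P hPA ⟨p, hp⟩ hcl
  refine Set.Subset.antisymm hPA ?_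
  intro v hv
  have hr := h.preconnected ⟨p, hPA hp⟩ ⟨v, hv⟩
  rw [reachable_iff_reflTransGen] at hr
  have : ∀ z : A, Relation.ReflTransGen (G.induce A).Adj ⟨p, hPA hp⟩ z → z.1 ∈ P := by
    intro z hz
    induction hz with
    | refl => exact hp
    | tail _ hbc ih => exact hcl _ ih _ (Subtype.property _) (by simpa using hbc)
  exact this _ hr

/-- Two vertex sets are joined by an edge. -/
def Tch (G : SimpleGraph V) (A B : Set V) : Prop := ∃ a ∈ A, ∃ b ∈ B, G.Adj a b

theorem Tch.symm {G : SimpleGraph V} {A B : Set V} (h : Tch G A B) : Tch G B A := by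
  obtain ⟨a, ha, b, hb, hab⟩ := h
  exact ⟨b, hb, a, ha, hab.symm⟩

theorem Tch.mono {G : SimpleGraph V} {A B A' B' : Set V} (h : Tch G A B) (hA : A ⊆ A')
    (hB : B ⊆ B') : Tch G A' B' := by
  obtain ⟨a, ha, b, hb, hab⟩ := h
  exact ⟨a, hA ha, b, hB hb, hab⟩

theorem Cn.union {G : SimpleGraph V} {A B : Set V} (hA : Cn G A) (hB : Cn G B)
    (h : Tch G A B) : Cn G (A ∪ B) := by
  obtain ⟨a, ha, b, hb, hab⟩ := h
  refine ⟨⟨a, Or.inl ha⟩, ?_⟩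
  rintro P hP ⟨p, hp⟩ hcl
  have hA' : (P ∩ A).Nonempty → A ⊆ P := by
    intro hne
    have := hA.2 (P ∩ A) Set.inter_subset_right hne
      (fun x hx y hy hxy => ⟨hcl x hx.1 y (Or.inl hy) hxy, hy⟩)
    rw [← this]; exact Set.inter_subset_left
  have hB' : (P ∩ B).Nonempty → B ⊆ P := by
    intro hne
    have := hB.2 (P ∩ B) Set.inter_subset_right hne
      (fun x hx y hy hxy => ⟨hcl x hx.1 y (Or.inr hy) hxy, hy⟩)
    rw [← this]; exact Set.inter_subset_left
  refine Set.Subset.antisymm hP ?_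
  rcases hP hp with h1 | h1
  · have := hA' ⟨p, hp, h1⟩
    have hbP := hcl a (this ha) b (Or.inr hb) hab
    exact Set.union_subset this (hB' ⟨b, hbP, hb⟩)
  · have := hB' ⟨p, hp, h1⟩
    have haP := hcl b (this hb) a (Or.inl ha) hab.symm
    exact Set.union_subset (hA' ⟨a, haP, ha⟩) this

theorem cn_singleton (G : SimpleGraph V) (a : V) : Cn G {a} := by
  refine ⟨⟨a, rfl⟩, ?_⟩
  rintro P hP hne _
  exact (Set.subset_singleton_iff_eq.mp hP).resolve_left hne.ne_empty

theorem Cn.mono {G G' : SimpleGraph V} (h : G' ≤ G) {A : Set V} (hA : Cn G' A) : Cn G A :=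
  ⟨hA.1, fun P hP hne hcl => hA.2 P hP hne (fun a ha b hb hab => hcl a ha b hb (h hab))⟩

/-- A connected subset of `D` is contained in a connected subset that is closed in `D`. -/
theorem exists_comp [Finite V] (G : SimpleGraph V) {A D : Set V} (hA : Cn G A) (hAD : A ⊆ D) :
    ∃ N, Cn G N ∧ A ⊆ N ∧ N ⊆ D ∧ ∀ a ∈ N, ∀ b ∈ D, G.Adj a b → b ∈ N := by
  obtain ⟨N, hN⟩ := Set.Finite.exists_maximal (s := {N : Set V | Cn G N ∧ A ⊆ N ∧ N ⊆ D})
    (Set.toFinite _) ⟨A, hA, subset_rfl, hAD⟩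
  refine ⟨N, hN.prop.1, hN.prop.2.1, hN.prop.2.2, ?_⟩
  intro a ha b hb hab
  have h1 : Cn G (N ∪ {b}) := hN.prop.1.union (cn_singleton G b) ⟨a, ha, b, rfl, hab⟩
  have h2 := hN.le_of_ge (y := N ∪ {b}) ⟨h1, hN.prop.2.1.trans Set.subset_union_left,
    Set.union_subset hN.prop.2.2 (by simpa using hb)⟩ Set.subset_union_left
  exact h2 (Or.inr rfl)

theorem no_K33 {G : SimpleGraph V} (hG : IsPlanar G) (f h : Fin 3 → Set V)
    (hf : ∀ i, Cn G (f i)) (hh : ∀ i, Cn G (h i))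
    (dff : Pairwise fun i j => Disjoint (f i) (f j))
    (dhh : Pairwise fun i j => Disjoint (h i) (h j))
    (dfh : ∀ i j, Disjoint (f i) (h j))
    (adj : ∀ i j, Tch G (f i) (h j)) : False := by
  refine hG.2 ⟨Sum.elim f h, ?_, ?_, ?_, ?_⟩
  · rintro (i | i)
    · exact (hf i).1
    · exact (hh i).1
  · rintro (i | i)
    · exact cn_connected (hf i)
    · exact cn_connected (hh i)
  · rintro (i | i) (j | j) hij
    · exact dff (by simpa using hij)
    · exact dfh i j
    · exact (dfh j i).symm
    · exact dhh (by simpa using hij)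
  · rintro (i | i) (j | j) hij
    · simp at hij
    · exact adj i j
    · exact (adj j i).symm
    · simp at hij

theorem no_K5 {G : SimpleGraph V} (hG : IsPlanar G) (f : Fin 5 → Set V)
    (hf : ∀ i, Cn G (f i)) (dff : ∀ i j, i < j → Disjoint (f i) (f j))
    (adj : ∀ i j, i < j → Tch G (f i) (f j)) : False := by
  refine hG.1 ⟨f, fun i => (hf i).1, fun i => cn_connected (hf i), ?_, ?_⟩
  · intro i j hij
    rcases lt_or_gt_of_ne hij with h | h
    · exact dff i j h
    · exact (dff j i h).symm
  · intro i j hij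
    have hij : i ≠ j := by simpa using hij
    rcases lt_or_gt_of_ne hij with h | h
    · exact adj i j h
    · exact (adj j i h).symm

theorem planar_mono {G G' : SimpleGraph V} (h : G' ≤ G) (hG : IsPlanar G) : IsPlanar G' := by
  have key : ∀ {W : Type} (K : SimpleGraph W), HasMinor G' K → HasMinor G K := by
    rintro W K ⟨B, h1, h2, h3, h4⟩
    refine ⟨B, h1, fun w => cn_connected ((connected_cn (h2 w)).mono h), h3, ?_⟩
    intro w w' hw
    obtain ⟨a, ha, b, hb, hab⟩ := h4 w w' hw
    exact ⟨a, ha, b, hb, h hab⟩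
  exact ⟨fun hm => hG.1 (key _ hm), fun hm => hG.2 (key _ hm)⟩

/-- Contract the edge `xy` onto `x`; `y` becomes isolated. -/
def ctr (G : SimpleGraph V) (x y : V) : SimpleGraph V where
  Adj a b := a ≠ y ∧ b ≠ y ∧ a ≠ b ∧ (G.Adj a b ∨ (a = x ∧ G.Adj y b) ∨ (b = x ∧ G.Adj y a))
  symm := ⟨by
    rintro a b ⟨h1, h2, h3, h4⟩
    refine ⟨h2, h1, h3.symm, ?_⟩
    rcases h4 with h | h | h
    · exact Or.inl h.symm
    · exact Or.inr (Or.inr h)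
    · exact Or.inr (Or.inl h)⟩
  loopless := ⟨fun a h => h.2.2.1 rfl⟩

theorem planar_ctr {G : SimpleGraph V} {x y : V} (hxy : G.Adj x y) (hG : IsPlanar G) :
    IsPlanar (ctr G x y) := by
  have key : ∀ {W : Type} (K : SimpleGraph W), (∀ w, ∃ w', K.Adj w w') →
      HasMinor (ctr G x y) K → HasMinor G K := by
    rintro W K hK ⟨B, h1, h2, h3, h4⟩
    have hy : ∀ w, y ∉ B w := by
      intro w hyw
      have hc := (connected_cn (h2 w)).2 {y} (by simpa using hyw) ⟨y, rfl⟩ (by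
        rintro a rfl b _ hab
        exact absurd rfl hab.1)
      obtain ⟨w', hw'⟩ := hK w
      obtain ⟨a, ha, b, hb, hab⟩ := h4 w w' hw'
      rw [← hc] at ha
      exact hab.1 ha
    let B' : W → Set V := fun w => B w ∪ {z | z = y ∧ x ∈ B w}
    refine ⟨B', fun w => (h1 w).mono Set.subset_union_left, ?_, ?_, ?_⟩
    · intro w
      apply cn_connected
      refine ⟨(h1 w).mono Set.subset_union_left, ?_⟩
      rintro P hP ⟨p, hp⟩ hcl
      have hxy' : x ∈ B w → (x ∈ P ↔ y ∈ P) := fun hx =>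
        ⟨fun h => hcl x h y (Or.inr ⟨rfl, hx⟩) hxy, fun h => hcl y h x (Or.inl hx) hxy.symm⟩
      have hne : (P ∩ B w).Nonempty := by
        rcases hP hp with h | ⟨rfl, h⟩
        · exact ⟨p, hp, h⟩
        · exact ⟨x, (hxy' h).2 hp, h⟩
      have := (connected_cn (h2 w)).2 (P ∩ B w) Set.inter_subset_right hne (by
        rintro a ⟨haP, haB⟩ b hb ⟨-, -, -, hab | ⟨rfl, hab⟩ | ⟨rfl, hab⟩⟩
        · exact ⟨hcl a haP b (Or.inl hb) hab, hb⟩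
        · exact ⟨hcl y ((hxy' haB).1 haP) b (Or.inl hb) hab, hb⟩
        · exact ⟨(hxy' hb).2 (hcl a haP y (Or.inr ⟨rfl, hb⟩) hab.symm), hb⟩)
      refine Set.Subset.antisymm hP ?_
      have hBP : B w ⊆ P := by rw [← this]; exact Set.inter_subset_left
      rintro z (hz | ⟨rfl, hz⟩)
      · exact hBP hz
      · exact (hxy' hz).1 (hBP hz)
    · intro w w' hww
      rw [Set.disjoint_left]
      have hd := Set.disjoint_left.mp (h3 hww)
      rintro z (hz | ⟨rfl, hz⟩) (hz' | ⟨hz'', hz'⟩)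
      · exact hd hz hz'
      · exact hy w (hz'' ▸ hz)
      · exact hy w' hz'
      · exact hd hz hz'
    · intro w w' hw
      obtain ⟨a, ha, b, hb, -, -, -, hab | ⟨rfl, hab⟩ | ⟨rfl, hab⟩⟩ := h4 w w' hw
      · exact ⟨a, Or.inl ha, b, Or.inl hb, hab⟩
      · exact ⟨y, Or.inr ⟨rfl, ha⟩, b, Or.inl hb, hab⟩
      · exact ⟨a, Or.inl ha, y, Or.inr ⟨rfl, hb⟩, hab.symm⟩
  refine ⟨fun hm => hG.1 (key _ ?_ hm), fun hm => hG.2 (key _ ?_ hm)⟩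
  · intro w
    exact ⟨w + 1, by simp⟩
  · rintro (w | w)
    · exact ⟨Sum.inr 0, by simp⟩
    · exact ⟨Sum.inl 0, by simp⟩

end basics

section euler
open scoped Classical
universe u
variable {V : Type u}

/-- The finite edge set. -/
noncomputable def ES [Fintype V] (G : SimpleGraph V) : Finset (Sym2 V) := G.edgeSet.toFinite.toFinset

theorem mem_ES [Fintype V] {G : SimpleGraph V} {e : Sym2 V} : e ∈ ES G ↔ e ∈ G.edgeSet := by
  simp [ES]

theorem mem_ES' [Fintype V] {G : SimpleGraph V} {a b : V} : s(a, b) ∈ ES G ↔ G.Adj a b := by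
  simp [ES]

/-- Reachability along a set of edges. -/
def Rc (F : Finset (Sym2 V)) : V → V → Prop :=
  Relation.ReflTransGen (fun a b => s(a, b) ∈ F)

/-- The edge set contains a cycle. -/
def Cy (F : Finset (Sym2 V)) : Prop := ∃ u v, s(u, v) ∈ F ∧ Rc (F.erase s(u, v)) u v

theorem Rc.refl {F : Finset (Sym2 V)} (a : V) : Rc F a a := Relation.ReflTransGen.refl

theorem Rc.trans {F : Finset (Sym2 V)} {a b c : V} (h : Rc F a b) (h' : Rc F b c) : Rc F a c :=
  Relation.ReflTransGen.trans h h'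

theorem Rc.single {F : Finset (Sym2 V)} {a b : V} (h : s(a, b) ∈ F) : Rc F a b :=
  Relation.ReflTransGen.single h

theorem Rc.symm {F : Finset (Sym2 V)} {a b : V} (h : Rc F a b) : Rc F b a := by
  induction h with
  | refl => exact Rc.refl _
  | tail _ hbc ih => exact (Rc.single (by rw [Sym2.eq_swap]; exact hbc)).trans ih

theorem Rc.mono {F F' : Finset (Sym2 V)} (hF : F ⊆ F') {a b : V} (h : Rc F a b) : Rc F' a b := by
  induction h with
  | refl => exact Rc.refl _
  | tail _ hbc ih => exact ih.trans (Rc.single (hF hbc))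

theorem Cy.mono {F F' : Finset (Sym2 V)} (hF : F ⊆ F') (h : Cy F) : Cy F' := by
  obtain ⟨u, v, huv, hr⟩ := h
  exact ⟨u, v, hF huv, hr.mono (Finset.erase_subset_erase _ hF)⟩

theorem cy_insert {A : Finset (Sym2 V)} {a b : V} (h : s(a, b) ∉ A) (hr : Rc A a b) :
    Cy (insert s(a, b) A) := by
  refine ⟨a, b, by simp, ?_⟩
  rwa [Finset.erase_insert h]

theorem rc_seg {F : Finset (Sym2 V)} {p : ℕ → V} {i j : ℕ} (hij : i ≤ j)
    (h : ∀ t, i ≤ t → t < j → s(p t, p (t + 1)) ∈ F) : Rc F (p i) (p j) := by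
  induction j, hij using Nat.le_induction with
  | base => exact Rc.refl _
  | succ j hij ih =>
    exact (ih (fun t h1 h2 => h t h1 (by omega))).trans (Rc.single (h j hij (by omega)))

/-- Edges of a segment of a path. -/
noncomputable def PE (p : ℕ → V) (i j : ℕ) : Finset (Sym2 V) :=
  (Finset.Ico i j).image (fun t => s(p t, p (t + 1)))

theorem mem_PE {p : ℕ → V} {i j : ℕ} {e : Sym2 V} :
    e ∈ PE p i j ↔ ∃ t, i ≤ t ∧ t < j ∧ s(p t, p (t + 1)) = e := by
  simp [PE, and_assoc]

theorem rc_PE {p : ℕ → V} {i j : ℕ} (hij : i ≤ j) : Rc (PE p i j) (p i) (p j) :=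
  rc_seg hij (fun t h1 h2 => mem_PE.2 ⟨t, h1, h2, rfl⟩)

/-- weight of a segment of a path -/
noncomputable def Ws (w : Sym2 V → ℝ) (p : ℕ → V) (i j : ℕ) : ℝ :=
  ∑ t ∈ Finset.Ico i j, w s(p t, p (t + 1))

theorem Ws_add (w : Sym2 V → ℝ) (p : ℕ → V) {i j k : ℕ} (h : i ≤ j) (h' : j ≤ k) :
    Ws w p i j + Ws w p j k = Ws w p i k :=
  Finset.sum_Ico_consecutive _ h h'

theorem edge_inj {p : ℕ → V} {n : ℕ} (inj : ∀ i ≤ n, ∀ j ≤ n, p i = p j → i = j) {i j : ℕ}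
    (hi : i < n) (hj : j < n) (h : s(p i, p (i + 1)) = s(p j, p (j + 1))) : i = j := by
  rw [Sym2.eq_iff] at h
  rcases h with ⟨h1, -⟩ | ⟨h1, h2⟩
  · exact inj _ hi.le _ hj.le h1
  · have := inj _ hi.le _ hj h1
    have := inj _ hi _ hj.le h2
    omega

theorem sum_PE (w : Sym2 V → ℝ) {p : ℕ → V} {n : ℕ}
    (inj : ∀ i ≤ n, ∀ j ≤ n, p i = p j → i = j) {i j : ℕ} (hj : j ≤ n) :
    ∑ e ∈ PE p i j, w e = Ws w p i j := by
  unfold PE Ws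
  rw [Finset.sum_image]
  intro a ha b hb hab
  simp at ha hb
  exact edge_inj inj (by omega) (by omega) hab

theorem rc_path {F : Finset (Sym2 V)} {x y : V} (h : Rc F x y) : ∃ (p : ℕ → V) (n : ℕ),
    p 0 = x ∧ p n = y ∧ (∀ i ≤ n, ∀ j ≤ n, p i = p j → i = j) ∧
    ∀ i < n, s(p i, p (i + 1)) ∈ F := by
  have hr : (SimpleGraph.fromEdgeSet (F : Set (Sym2 V))).Reachable x y := by
    induction h with
    | refl => exact Reachable.refl _
    | @tail b c _ hbc ih =>
      by_cases hb : b = c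
      · exact hb ▸ ih
      · exact ih.trans (Adj.reachable (by simp [hb]; exact hbc))
  obtain ⟨q, hq⟩ := hr.exists_isPath
  refine ⟨q.getVert, q.length, q.getVert_zero, q.getVert_length, ?_, ?_⟩
  · intro i hi j hj hij
    exact hq.getVert_injOn hi hj hij
  · intro i hi
    have := q.adj_getVert_succ hi
    simp at this
    exact this.1

/-- cycle weight condition -/
def CW [Fintype V] (G : SimpleGraph V) (w : Sym2 V → ℝ) : Prop :=
  ∀ F ⊆ ES G, Cy F → 1 ≤ ∑ e ∈ F, w e

theorem rs_forest [Fintype V] (G : SimpleGraph V) (S : Finset V) (hS : S.Nonempty)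
    (hE : ∀ a b, G.Adj a b → a ∈ S ∧ b ∈ S) (hc : ¬ Cy (ES G)) :
    (ES G).card + 1 ≤ S.card := by
  have hac : G.IsAcyclic := by
    rw [isAcyclic_iff_forall_adj_isBridge]
    intro v w hvw
    rw [isBridge_iff]
    intro hr
    apply hc
    refine ⟨v, w, mem_ES'.2 hvw, ?_⟩
    rw [reachable_iff_reflTransGen] at hr
    refine Relation.ReflTransGen.mono (fun a b hab => ?_) _ _ hr
    simp at hab
    simp [mem_ES', hab]
    tauto
  have hac' : (G.induce (S : Set V)).IsAcyclic := hac.induce _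
  have : Nonempty (S : Set V) := ⟨⟨hS.choose, hS.choose_spec⟩⟩
  obtain ⟨T, hT1, -, hT⟩ := Connected.exists_isTree_le_of_le_of_isAcyclic
    (G := (⊤ : SimpleGraph (S : Set V))) connected_top le_top hac'
  have h1 := hT.card_edgeFinset
  have h2 : (ES G).card ≤ T.edgeFinset.card := by
    refine Finset.card_le_card_of_surjOn (fun e => e.map Subtype.val) ?_
    intro e he
    induction e with
    | _ a b =>
      have hab : G.Adj a b := mem_ES'.1 he
      refine ⟨s(⟨a, (hE a b hab).1⟩, ⟨b, (hE a b hab).2⟩), ?_, rfl⟩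
      simp
      exact hT1 (by simpa using hab)
  have h3 : Fintype.card (S : Set V) = S.card := by simp
  omega

/-- The Euler type inequality for one weighted graph. -/
def EulP [Fintype V] (G : SimpleGraph V) (S : Finset V) (w : Sym2 V → ℝ) : Prop :=
  ((ES G).card : ℝ) - S.card + 2 ≤ 2 * ∑ e ∈ ES G, w e

/-- The standing hypotheses of the Euler type inequality. -/
structure Hyp [Fintype V] (G : SimpleGraph V) (S : Finset V) (w : Sym2 V → ℝ) : Prop where
  pl : IsPlanar G
  sup : ∀ a b, G.Adj a b → a ∈ S ∧ b ∈ S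
  nn : ∀ e ∈ ES G, 0 ≤ w e
  cw : CW G w
  cy : Cy (ES G)

/-- Induction hypothesis. -/
def IHyp (V : Type u) [Fintype V] (m : ℕ) : Prop :=
  ∀ (G : SimpleGraph V) (S : Finset V) (w : Sym2 V → ℝ), S.card + (ES G).card < m →
    Hyp G S w → EulP G S w

theorem Hyp.ne [Fintype V] {G : SimpleGraph V} {S : Finset V} {w : Sym2 V → ℝ}
    (h : Hyp G S w) : S.Nonempty := by
  obtain ⟨u, v, huv, -⟩ := h.cy
  exact ⟨u, (h.sup u v (mem_ES'.1 huv)).1⟩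

theorem ES_delete [Fintype V] (G : SimpleGraph V) (e : Sym2 V) :
    ES (G.deleteEdges {e}) = (ES G).erase e := by
  ext f
  simp [mem_ES, and_comm]

theorem L1 [Fintype V] {G : SimpleGraph V} {S : Finset V} {w : Sym2 V → ℝ}
    (ih : IHyp V (S.card + (ES G).card)) (h : Hyp G S w) (hb : ¬ EulP G S w)
    {e : Sym2 V} (he : e ∈ ES G) : w e < 1 / 2 := by
  by_contra hw
  push Not at hw
  apply hb
  have hcard := Finset.card_erase_add_one he
  have hsum := Finset.sum_erase_add (ES G) w he
  have hle : G.deleteEdges {e} ≤ G := deleteEdges_le _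
  unfold EulP
  by_cases hc : Cy (ES (G.deleteEdges {e}))
  · have := ih (G.deleteEdges {e}) S w (by rw [ES_delete]; omega)
      ⟨planar_mono hle h.pl, fun a b hab => h.sup a b (hle hab),
        fun f hf => h.nn f (by rw [ES_delete] at hf; exact Finset.mem_of_mem_erase hf),
        fun F hF hF' => h.cw F (by
          rw [ES_delete] at hF; exact hF.trans (Finset.erase_subset _ _)) hF', hc⟩
    unfold EulP at this
    rw [ES_delete] at this
    have h1 : ((ES G).card : ℝ) = ((ES G).erase e).card + 1 := by exact_mod_cast hcard.symm
    linarith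
  · have h1 := rs_forest _ S h.ne (fun a b hab => h.sup a b (hle hab)) hc
    rw [ES_delete] at h1
    have h2 := h.cw _ subset_rfl h.cy
    have h3 : ((ES G).card : ℝ) ≤ S.card := by exact_mod_cast (by omega : (ES G).card ≤ S.card)
    linarith

/-- Restriction to a vertex set. -/
def rs (G : SimpleGraph V) (T : Set V) : SimpleGraph V where
  Adj a b := G.Adj a b ∧ a ∈ T ∧ b ∈ T
  symm := ⟨fun _ _ h => ⟨h.1.symm, h.2.2, h.2.1⟩⟩
  loopless := ⟨fun _ h => h.1.ne rfl⟩

theorem rs_le (G : SimpleGraph V) (T : Set V) : rs G T ≤ G := fun _ _ h => h.1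

end euler

section contraction
open scoped Classical
universe u
set_option linter.unusedSectionVars false
variable {V : Type u} [Fintype V]

theorem Rc.lift {F H : Finset (Sym2 V)} {u v : V} (h : Rc F u v)
    (hs : ∀ a b, s(a, b) ∈ F → Rc H a b) : Rc H u v := by
  induction h with
  | refl => exact Rc.refl _
  | tail _ hbc ih => exact ih.trans (hs _ _ hbc)

/-- The contraction map on vertices. -/
noncomputable def cph (x y z : V) : V := if z = y then x else z

theorem ctr_adj_iff {G : SimpleGraph V} {x y : V} (hxy : G.Adj x y) {a b : V} :
    (ctr G x y).Adj a b ↔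
      ∃ c d, G.Adj c d ∧ s(c, d) ≠ s(x, y) ∧ cph x y c = a ∧ cph x y d = b := by
  have hne := hxy.ne
  constructor
  · rintro ⟨h1, h2, h3, h4 | ⟨rfl, h4⟩ | ⟨rfl, h4⟩⟩
    · refine ⟨a, b, h4, ?_, by simp [cph, h1], by simp [cph, h2]⟩
      rw [Ne, Sym2.eq_iff]; tauto
    · refine ⟨y, b, h4, ?_, by simp [cph], by simp [cph, h2]⟩
      rw [Ne, Sym2.eq_iff]
      rintro (⟨h, -⟩ | ⟨-, h⟩)
      · exact hne h.symm
      · exact h3 h.symm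
    · refine ⟨a, y, h4.symm, ?_, by simp [cph, h1], by simp [cph]⟩
      rw [Ne, Sym2.eq_iff]
      rintro (⟨h, -⟩ | ⟨-, h⟩)
      · exact h3 h
      · exact hne h.symm
  · rintro ⟨c, d, h1, h2, rfl, rfl⟩
    rw [Ne, Sym2.eq_iff] at h2
    have h3 := h1.ne
    unfold cph
    by_cases hc : c = y
    · subst hc
      have hd : d ≠ c := fun h => h3 h.symm
      have hd' : d ≠ x := fun h => h2 (Or.inr ⟨rfl, h⟩)
      simp only [if_true, if_neg hd]
      exact ⟨hne, hd, hd'.symm, Or.inr (Or.inl ⟨rfl, h1⟩)⟩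
    · by_cases hd : d = y
      · subst hd
        have hc' : c ≠ x := fun h => h2 (Or.inl ⟨h, rfl⟩)
        simp only [if_true, if_neg hc]
        exact ⟨hc, hne, hc', Or.inr (Or.inr ⟨rfl, h1.symm⟩)⟩
      · simp only [if_neg hc, if_neg hd]
        exact ⟨hc, hd, h3, Or.inl h1⟩

theorem cph_eq {x y a c : V} (h : cph x y a = cph x y c) (hac : a ≠ c) :
    (a = x ∧ c = y) ∨ (a = y ∧ c = x) := by
  unfold cph at h
  split_ifs at h with h1 h2 h2
  · exact absurd (h1.trans h2.symm) hac
  · exact Or.inr ⟨h1, h.symm⟩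
  · exact Or.inl ⟨h, h2⟩
  · exact absurd h hac

theorem L2 {G : SimpleGraph V} {S : Finset V} {w : Sym2 V → ℝ}
    (ih : IHyp V (S.card + (ES G).card)) (h : Hyp G S w) (hb : ¬ EulP G S w)
    {e : Sym2 V} (he : e ∈ ES G) : 0 < w e := by
  by_contra hw
  have hw0 : w e = 0 := le_antisymm (not_lt.mp hw) (h.nn e he)
  induction e with
  | _ x y =>
  have hxy : G.Adj x y := mem_ES'.1 he
  have htri : ∀ z, G.Adj x z → G.Adj y z → False := by
    intro z h1 h2
    have hx := L1 ih h hb (mem_ES'.2 h1)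
    have hy := L1 ih h hb (mem_ES'.2 h2)
    have hcy : Cy (insert s(x, y) {s(x, z), s(y, z)}) := by
      apply cy_insert
      · simp only [Finset.mem_insert, Finset.mem_singleton, Sym2.eq_iff]
        have := h1.ne; have := h2.ne; have := hxy.ne
        grind
      · exact (Rc.single (b := z) (by simp)).trans (Rc.single (by rw [Sym2.eq_swap]; simp))
    have := h.cw _ (by
      intro f hf
      simp only [Finset.mem_insert, Finset.mem_singleton] at hf
      rcases hf with rfl | rfl | rfl
      · exact he
      · exact mem_ES'.2 h1
      · exact mem_ES'.2 h2) hcy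
    rw [Finset.sum_insert, Finset.sum_insert, Finset.sum_singleton] at this
    · linarith
    · simp only [Finset.mem_singleton, Sym2.eq_iff]
      have := h1.ne; have := h2.ne; have := hxy.ne
      grind
    · simp only [Finset.mem_insert, Finset.mem_singleton, Sym2.eq_iff]
      have := h1.ne; have := h2.ne; have := hxy.ne
      grind
  set E0 := (ES G).erase s(x, y) with hE0
  set φ := Sym2.map (cph x y) with hφ
  have hcard : E0.card + 1 = (ES G).card := Finset.card_erase_add_one he
  have hsum : ∑ f ∈ E0, w f + w s(x, y) = ∑ f ∈ ES G, w f := Finset.sum_erase_add (ES G) w he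
  have himg : ES (ctr G x y) = E0.image φ := by
    ext f
    induction f with
    | _ a b =>
    rw [mem_ES', ctr_adj_iff hxy, Finset.mem_image]
    constructor
    · rintro ⟨c, d, h1, h2, rfl, rfl⟩
      exact ⟨s(c, d), by simp [hE0, mem_ES', h1]; simpa using h2, by simp [hφ]⟩
    · rintro ⟨f, hf, hf'⟩
      induction f with
      | _ c d =>
      rw [hE0, Finset.mem_erase, mem_ES'] at hf
      simp only [hφ, Sym2.map_mk, Sym2.eq_iff] at hf'
      rcases hf' with ⟨h1, h2⟩ | ⟨h1, h2⟩
      · exact ⟨c, d, hf.2, hf.1, h1, h2⟩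
      · exact ⟨d, c, hf.2.symm, by rw [Sym2.eq_swap]; exact hf.1, h2, h1⟩
  have hinj : Set.InjOn φ E0 := by
    have key : ∀ a b c d, s(a, b) ∈ E0 → s(c, d) ∈ E0 → cph x y a = cph x y c →
        cph x y b = cph x y d → s(a, b) = s(c, d) := by
      intro a b c d h1 h2 h3 h4
      rw [hE0, Finset.mem_erase, mem_ES', Ne, Sym2.eq_iff] at h1 h2
      obtain ⟨n1, a1⟩ := h1
      obtain ⟨n2, a2⟩ := h2
      have q1 := a1.ne
      have q2 := a2.ne
      have q3 := htri
      by_cases hac : a = c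
      · by_cases hbd : b = d
        · rw [hac, hbd]
        · subst hac
          rcases cph_eq h4 hbd with ⟨rfl, rfl⟩ | ⟨rfl, rfl⟩
          · exact (htri a a1.symm a2.symm).elim
          · exact (htri a a2.symm a1.symm).elim
      · by_cases hbd : b = d
        · subst hbd
          rcases cph_eq h3 hac with ⟨rfl, rfl⟩ | ⟨rfl, rfl⟩
          · exact (htri b a1 a2).elim
          · exact (htri b a2 a1).elim
        · have r1 := cph_eq h3 hac
          have r2 := cph_eq h4 hbd
          grind
    intro f hf g hg hfg
    induction f with
    | _ a b =>
    induction g with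
    | _ c d =>
    simp only [hφ, Sym2.map_mk, Sym2.eq_iff] at hfg
    rcases hfg with ⟨h1, h2⟩ | ⟨h1, h2⟩
    · exact key a b c d hf hg h1 h2
    · have := key a b d c hf (by rw [Sym2.eq_swap]; exact hg) h1 h2
      rw [this, Sym2.eq_swap]
  have hcard' : (ES (ctr G x y)).card = E0.card := by
    rw [himg, Finset.card_image_of_injOn hinj]
  let w' : Sym2 V → ℝ := fun f' => ∑ f ∈ E0 with φ f = f', w f
  have hw' : ∀ F' : Finset (Sym2 V), ∑ f' ∈ F', w' f' = ∑ f ∈ E0 with φ f ∈ F', w f := by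
    intro F'
    rw [← Finset.sum_fiberwise_of_maps_to (s := E0.filter (fun f => φ f ∈ F')) (t := F') (g := φ)
      (fun f hf => (Finset.mem_filter.1 hf).2)]
    refine Finset.sum_congr rfl (fun f' hf' => ?_)
    refine Finset.sum_congr ?_ (fun _ _ => rfl)
    ext f
    simp only [Finset.mem_filter]
    constructor
    · rintro ⟨h1, rfl⟩; exact ⟨⟨h1, hf'⟩, rfl⟩
    · rintro ⟨⟨h1, -⟩, h2⟩; exact ⟨h1, h2⟩
  have hsup : ∀ a b, (ctr G x y).Adj a b → a ∈ S.erase y ∧ b ∈ S.erase y := by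
    intro a b hab
    have hxS := (h.sup x y hxy).1
    obtain ⟨h1, h2, h3, h4 | ⟨rfl, h4⟩ | ⟨rfl, h4⟩⟩ := hab
    · simp [h1, h2, h.sup a b h4]
    · simp [h1, h2, hxS, (h.sup y b h4).2]
    · simp [h1, h2, hxS, (h.sup y a h4).2]
  have hyS := (h.sup x y hxy).2
  have hScard := Finset.card_erase_add_one hyS
  have hcw : CW (ctr G x y) w' := by
    intro F' hF' ⟨u, v, huv, hr⟩
    rw [hw']
    set F0 := E0.filter (fun f => φ f ∈ F') with hF0
    have hlift : ∀ a b, s(a, b) ∈ F' → ∃ c d, s(c, d) ∈ F0 ∧ cph x y c = a ∧ cph x y d = b := by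
      intro a b hab
      have h1 := hF' hab
      rw [mem_ES', ctr_adj_iff hxy] at h1
      obtain ⟨c, d, h1, h2, rfl, rfl⟩ := h1
      refine ⟨c, d, ?_, rfl, rfl⟩
      rw [hF0, Finset.mem_filter, hE0, Finset.mem_erase, mem_ES']
      exact ⟨⟨h2, h1⟩, by simpa [hφ] using hab⟩
    have heF0 : s(x, y) ∉ F0 := by simp [hF0, hE0]
    obtain ⟨c, d, hcd, hcu, hdv⟩ := hlift u v huv
    have hfe : s(x, y) ≠ s(c, d) := fun hh => heF0 (hh ▸ hcd)
    have hcy : Cy (insert s(x, y) F0) := by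
      refine ⟨c, d, Finset.mem_insert_of_mem hcd, ?_⟩
      set H := (insert s(x, y) F0).erase s(c, d) with hH
      have hz : ∀ z, Rc H z (cph x y z) := by
        intro z
        unfold cph
        split_ifs with hzy
        · subst hzy
          apply Rc.symm
          apply Rc.single
          simp [hH, hfe]
        · exact Rc.refl _
      have hs : ∀ a b, s(a, b) ∈ F'.erase s(u, v) → Rc H a b := by
        intro a b hab
        obtain ⟨c', d', h1, rfl, rfl⟩ := hlift a b (Finset.mem_of_mem_erase hab)
        refine (hz c').symm.trans (Rc.trans (Rc.single ?_) (hz d'))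
        rw [hH, Finset.mem_erase]
        refine ⟨?_, Finset.mem_insert_of_mem h1⟩
        intro hh
        apply (Finset.mem_erase.1 hab).1
        have : φ s(c', d') = φ s(c, d) := by rw [hh]
        simpa [hφ, hcu, hdv] using this
      have huv' : Rc H u v := hr.lift hs
      have h1 := hz c
      have h2 := hz d
      rw [hcu] at h1
      rw [hdv] at h2
      exact (h1.trans huv').trans h2.symm
    have := h.cw _ (by
      intro f hf
      rcases Finset.mem_insert.1 hf with rfl | hf
      · exact he
      · exact Finset.mem_of_mem_erase (Finset.mem_filter.1 hf).1) hcy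
    rw [Finset.sum_insert heF0, hw0, zero_add] at this
    exact this
  have hwE : ∑ f' ∈ ES (ctr G x y), w' f' = ∑ f ∈ E0, w f := by
    rw [hw', Finset.filter_true_of_mem]
    intro f hf
    rw [himg]
    exact Finset.mem_image_of_mem _ hf
  apply hb
  have hm : ((ES G).card : ℝ) = E0.card + 1 := by exact_mod_cast hcard.symm
  have hn : (S.card : ℝ) = (S.erase y).card + 1 := by exact_mod_cast hScard.symm
  unfold EulP
  by_cases hc : Cy (ES (ctr G x y))
  · have := ih (ctr G x y) (S.erase y) w' (by omega)
      ⟨planar_ctr hxy h.pl, hsup, fun f _ => Finset.sum_nonneg (fun g hg =>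
        h.nn g (Finset.mem_of_mem_erase (Finset.mem_filter.1 hg).1)), hcw, hc⟩
    unfold EulP at this
    rw [hwE, hcard'] at this
    linarith
  · have h1 := rs_forest _ (S.erase y) ⟨x, by simp [hxy.ne, (h.sup x y hxy).1]⟩ hsup hc
    rw [hcard'] at h1
    have h2 := h.cw _ subset_rfl h.cy
    have h3 : (E0.card : ℝ) + 1 ≤ (S.erase y).card := by exact_mod_cast h1
    linarith

end contraction

section tight
open scoped Classical
universe u
set_option linter.unusedSectionVars false
variable {V : Type u} [Fintype V]

/-- A counterexample with all weights strictly between `0` and `1/2`. -/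
structure Bad (G : SimpleGraph V) (S : Finset V) (w : Sym2 V → ℝ) : Prop where
  ih : IHyp V (S.card + (ES G).card)
  hyp : Hyp G S w
  bad : ¬ EulP G S w

theorem Bad.pos {G : SimpleGraph V} {S : Finset V} {w : Sym2 V → ℝ} (h : Bad G S w)
    {e : Sym2 V} (he : e ∈ ES G) : 0 < w e := L2 h.ih h.hyp h.bad he

theorem Bad.half {G : SimpleGraph V} {S : Finset V} {w : Sym2 V → ℝ} (h : Bad G S w)
    {e : Sym2 V} (he : e ∈ ES G) : w e < 1 / 2 := L1 h.ih h.hyp h.bad he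

/-- A cycle of weight one through the edge `xy`, presented as a path from `x` to `y`. -/
structure TP (G : SimpleGraph V) (w : Sym2 V → ℝ) (x y : V) (p : ℕ → V) (n : ℕ) : Prop where
  h0 : p 0 = x
  hn : p n = y
  inj : ∀ i ≤ n, ∀ j ≤ n, p i = p j → i = j
  adj : ∀ i < n, G.Adj (p i) (p (i + 1))
  exy : G.Adj x y
  two : 2 ≤ n
  wt : Ws w p 0 n + w s(x, y) = 1

/-- A tight edge set. -/
def Tight (G : SimpleGraph V) (w : Sym2 V → ℝ) (F : Finset (Sym2 V)) : Prop :=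
  F ⊆ ES G ∧ Cy F ∧ ∑ e ∈ F, w e = 1

/-- The edge set of the cycle. -/
noncomputable def CE (x y : V) (p : ℕ → V) (n : ℕ) : Finset (Sym2 V) := insert s(x, y) (PE p 0 n)

theorem TP.ne {G : SimpleGraph V} {w : Sym2 V → ℝ} {x y : V} {p : ℕ → V} {n : ℕ}
    (h : TP G w x y p n) {i : ℕ} (hi : i < n) : s(p i, p (i + 1)) ≠ s(x, y) := by
  intro hh
  rw [← h.h0, ← h.hn, Sym2.eq_iff] at hh
  have h2 := h.two
  rcases hh with ⟨h1, h2⟩ | ⟨h1, h2⟩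
  · have := h.inj _ hi.le _ (by omega) h1
    have := h.inj _ hi _ (by omega) h2
    omega
  · have := h.inj _ hi.le _ (by omega) h1
    omega

theorem TP.notMem {G : SimpleGraph V} {w : Sym2 V → ℝ} {x y : V} {p : ℕ → V} {n : ℕ}
    (h : TP G w x y p n) {i j : ℕ} (hj : j ≤ n) : s(x, y) ∉ PE p i j := by
  rw [mem_PE]
  rintro ⟨t, -, h1, h2⟩
  exact h.ne (by omega) h2

theorem TP.sub {G : SimpleGraph V} {w : Sym2 V → ℝ} {x y : V} {p : ℕ → V} {n : ℕ}
    (h : TP G w x y p n) {i j : ℕ} (hj : j ≤ n) : PE p i j ⊆ ES G := by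
  intro e he
  rw [mem_PE] at he
  obtain ⟨t, -, h1, rfl⟩ := he
  exact mem_ES'.2 (h.adj t (by omega))

theorem TP.tight {G : SimpleGraph V} {w : Sym2 V → ℝ} {x y : V} {p : ℕ → V} {n : ℕ}
    (h : TP G w x y p n) : Tight G w (CE x y p n) := by
  refine ⟨?_, ?_, ?_⟩
  · intro e he
    rcases Finset.mem_insert.1 he with rfl | he
    · exact mem_ES'.2 h.exy
    · exact h.sub le_rfl he
  · apply cy_insert (h.notMem le_rfl)
    have := rc_PE (p := p) (Nat.zero_le n)
    rwa [h.h0, h.hn] at this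
  · rw [CE, Finset.sum_insert (h.notMem le_rfl), sum_PE w h.inj le_rfl, add_comm]
    exact h.wt

theorem Ws_rev (w : Sym2 V → ℝ) (p : ℕ → V) (n : ℕ) {i j : ℕ} (hij : i ≤ j) (hj : j ≤ n) :
    Ws w (fun i => p (n - i)) i j = Ws w p (n - j) (n - i) := by
  unfold Ws
  refine Finset.sum_nbij' (fun t => n - 1 - t) (fun t => n - 1 - t) ?_ ?_ ?_ ?_ ?_
  · intro t ht; simp at ht ⊢; omega
  · intro t ht; simp at ht ⊢; omega
  · intro t ht; simp at ht ⊢; omega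
  · intro t ht; simp at ht ⊢; omega
  · intro t ht
    simp at ht
    have h1 : n - t = n - 1 - t + 1 := by omega
    have h2 : n - (t + 1) = n - 1 - t := by omega
    beta_reduce
    rw [h1, h2, Sym2.eq_swap]

theorem TP.rev {G : SimpleGraph V} {w : Sym2 V → ℝ} {x y : V} {p : ℕ → V} {n : ℕ}
    (h : TP G w x y p n) : TP G w y x (fun i => p (n - i)) n := by
  refine ⟨by simp [h.hn], by simp [h.h0], ?_, ?_, h.exy.symm, h.two, ?_⟩
  · intro i hi j hj hij
    have := h.inj (n - i) (by omega) (n - j) (by omega) hij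
    omega
  · intro i hi
    have := h.adj (n - (i + 1)) (by omega)
    rw [show n - (i + 1) + 1 = n - i by omega] at this
    exact this.symm
  · rw [Ws_rev w p n (Nat.zero_le _) le_rfl, Sym2.eq_swap]
    simpa using h.wt

theorem tight_of_rc {G : SimpleGraph V} {S : Finset V} {w : Sym2 V → ℝ} (hB : Bad G S w)
    {F : Finset (Sym2 V)} (hF : Tight G w F) {x y : V} (hxy : s(x, y) ∈ F)
    (hr : Rc (F.erase s(x, y)) x y) : ∃ p n, TP G w x y p n ∧ F = CE x y p n := by
  obtain ⟨p, n, h0, hn, inj, hst⟩ := rc_path hr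
  have hadj : G.Adj x y := mem_ES'.1 (hF.1 hxy)
  have hsub : PE p 0 n ⊆ F.erase s(x, y) := by
    intro e he
    obtain ⟨t, -, h1, rfl⟩ := mem_PE.1 he
    exact hst t h1
  have hnm : s(x, y) ∉ PE p 0 n := fun hh => by simpa using hsub hh
  have hcy : Cy (CE x y p n) := by
    apply cy_insert hnm
    have := rc_PE (p := p) (Nat.zero_le n)
    rwa [h0, hn] at this
  have hCF : CE x y p n ⊆ F := by
    intro e he
    rcases Finset.mem_insert.1 he with rfl | he
    · exact hxy
    · exact Finset.mem_of_mem_erase (hsub he)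
  have hw := hB.hyp.cw _ (hCF.trans hF.1) hcy
  have hEq : F = CE x y p n := by
    by_contra hne
    have : ∃ e ∈ F, e ∉ CE x y p n := by
      by_contra hcon
      push Not at hcon
      exact hne (Finset.Subset.antisymm hcon hCF)
    obtain ⟨e, he, he'⟩ := this
    have := Finset.sum_lt_sum_of_subset hCF he he' (hB.pos (hF.1 he))
      (fun j hj _ => (hB.pos (hF.1 hj)).le)
    have := hF.2.2
    linarith
  refine ⟨p, n, ⟨h0, hn, inj, ?_, hadj, ?_, ?_⟩, hEq⟩
  · intro i hi
    exact mem_ES'.1 (hF.1 (Finset.mem_of_mem_erase (hst i hi)))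
  · by_contra hlt
    have : n = 0 ∨ n = 1 := by omega
    rcases this with rfl | rfl
    · exact hadj.ne (h0.symm.trans hn)
    · have := hst 0 (by omega)
      simp [h0, hn] at this
  · have := hF.2.2
    rw [hEq, CE, Finset.sum_insert hnm, sum_PE w inj le_rfl] at this
    linarith

theorem tight_path {G : SimpleGraph V} {S : Finset V} {w : Sym2 V → ℝ} (hB : Bad G S w)
    {F : Finset (Sym2 V)} (hF : Tight G w F) {x y : V} (hxy : s(x, y) ∈ F) :
    ∃ p n, TP G w x y p n ∧ F = CE x y p n := by
  obtain ⟨u, v, huv, hr⟩ := hF.2.1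
  obtain ⟨p, n, hp, hE⟩ := tight_of_rc hB hF huv hr
  apply tight_of_rc hB hF hxy
  have hxy' := hxy
  rw [hE] at hxy
  rcases Finset.mem_insert.1 hxy with h | h
  · rw [h]
    rcases Sym2.eq_iff.1 h with ⟨rfl, rfl⟩ | ⟨rfl, rfl⟩
    · exact hr
    · exact hr.symm
  · obtain ⟨t, -, ht, hte⟩ := mem_PE.1 h
    have hin : ∀ s, s < n → s ≠ t → s(p s, p (s + 1)) ∈ F.erase s(x, y) := by
      intro s hs hst
      rw [← hte, Finset.mem_erase, hE]
      exact ⟨fun hh => hst (edge_inj hp.inj hs ht hh),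
        Finset.mem_insert_of_mem (mem_PE.2 ⟨s, by omega, hs, rfl⟩)⟩
    have r1 : Rc (F.erase s(x, y)) (p 0) (p t) :=
      rc_seg (Nat.zero_le t) (fun s _ h2 => hin s (by omega) (by omega))
    have r2 : Rc (F.erase s(x, y)) (p (t + 1)) (p n) :=
      rc_seg (by omega) (fun s _ h2 => hin s (by omega) (by omega))
    have r3 : Rc (F.erase s(x, y)) (p 0) (p n) := by
      rw [hp.h0, hp.hn]
      apply Rc.single
      rw [Finset.mem_erase]
      exact ⟨fun hh => hp.ne ht (hte.trans hh.symm), huv⟩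
    have r4 : Rc (F.erase s(x, y)) (p t) (p (t + 1)) := (r1.symm.trans r3).trans r2.symm
    rcases Sym2.eq_iff.1 hte with ⟨h1, h2⟩ | ⟨h1, h2⟩
    · rwa [h1, h2] at r4
    · rw [h1, h2] at r4
      exact r4.symm

theorem sum_union_le_aux {A B : Finset (Sym2 V)} {w : Sym2 V → ℝ} (hB : ∀ e ∈ A, 0 ≤ w e) :
    ∑ e ∈ A ∪ B, w e ≤ ∑ e ∈ A, w e + ∑ e ∈ B, w e := by
  rw [← Finset.sum_union_inter]
  have : 0 ≤ ∑ e ∈ A ∩ B, w e :=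
    Finset.sum_nonneg (fun e he => hB e (Finset.mem_inter.1 he).1)
  linarith

/-- Basic consequence of the cycle condition. -/
theorem Bad.cyc {G : SimpleGraph V} {S : Finset V} {w : Sym2 V → ℝ} (hB : Bad G S w)
    {A B : Finset (Sym2 V)} {a b c : V} (hA : A ⊆ ES G) (hB' : B ⊆ ES G) (hab : G.Adj a b)
    (h1 : s(a, b) ∉ A) (h2 : s(a, b) ∉ B) (r1 : Rc A a c) (r2 : Rc B c b) :
    1 ≤ w s(a, b) + (∑ e ∈ A, w e + ∑ e ∈ B, w e) := by
  have hn : s(a, b) ∉ A ∪ B := by simp [h1, h2]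
  have := hB.hyp.cw (insert s(a, b) (A ∪ B)) (by
    intro f hf
    rcases Finset.mem_insert.1 hf with rfl | hf
    · exact mem_ES'.2 hab
    · exact Finset.union_subset hA hB' hf)
    (cy_insert hn ((r1.mono Finset.subset_union_left).trans (r2.mono Finset.subset_union_right)))
  rw [Finset.sum_insert hn] at this
  have h3 := sum_union_le_aux (A := A) (B := B) (w := w) (fun e he => (hB.pos (hA he)).le)
  linarith

/-- Chordless. -/
theorem chordless {G : SimpleGraph V} {S : Finset V} {w : Sym2 V → ℝ} (hB : Bad G S w)
    {x y : V} {p : ℕ → V} {n : ℕ} (hp : TP G w x y p n) {i j : ℕ} (hij : i < j) (hj : j ≤ n)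
    (hadj : G.Adj (p i) (p j)) : s(p i, p j) ∈ CE x y p n := by
  by_contra hnot
  have hnP : ∀ a b, b ≤ n → s(p i, p j) ∉ PE p a b := by
    intro a b hb hh
    obtain ⟨t, h1, h2, h3⟩ := mem_PE.1 hh
    exact hnot (Finset.mem_insert_of_mem (mem_PE.2 ⟨t, by omega, by omega, h3⟩))
  have hne : s(p i, p j) ≠ s(x, y) := fun hh => hnot (by rw [hh]; exact Finset.mem_insert_self _ _)
  have c1 := hB.cyc (A := PE p i j) (B := ∅) (hp.sub hj) (by simp) hadj (hnP i j hj) (by simp)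
    (rc_PE hij.le) (Rc.refl _)
  have hA : insert s(x, y) (PE p 0 i) ⊆ ES G := by
    intro e he
    rcases Finset.mem_insert.1 he with rfl | he
    · exact mem_ES'.2 hp.exy
    · exact hp.sub (by omega) he
  have c2 := hB.cyc (A := insert s(x, y) (PE p 0 i)) (B := PE p j n) (c := y) hA (hp.sub le_rfl)
    hadj (by
      rw [Finset.mem_insert]
      rintro (h | h)
      · exact hne h
      · exact hnP _ _ (by omega) h) (hnP _ _ le_rfl)
    (by
      have r1 := (rc_PE (p := p) (Nat.zero_le i)).mono (Finset.subset_insert s(x, y) _)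
      rw [hp.h0] at r1
      exact r1.symm.trans (Rc.single (Finset.mem_insert_self _ _)))
    (by
      have r1 := (rc_PE (p := p) hj).symm
      rwa [hp.hn] at r1)
  rw [Finset.sum_insert (hp.notMem (by omega)), sum_PE w hp.inj (by omega),
    sum_PE w hp.inj le_rfl] at c2
  rw [sum_PE w hp.inj (by omega), Finset.sum_empty] at c1
  have e1 := Ws_add w p (Nat.zero_le i) hij.le
  have e2 := Ws_add w p (Nat.zero_le j) hj
  have e3 := hp.wt
  have e4 := hB.half (mem_ES'.2 hadj)
  linarith

/-- vertices of a path -/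
def VS (p : ℕ → V) (n : ℕ) : Set V := {v | ∃ i ≤ n, p i = v}

theorem L3 {G : SimpleGraph V} {S : Finset V} {w : Sym2 V → ℝ} (hB : Bad G S w)
    {x y : V} {p : ℕ → V} {n : ℕ} (hp : TP G w x y p n) {P : Set V}
    (hP : P ⊆ (S : Set V) \ VS p n) (hne : P.Nonempty)
    (hcl : ∀ a ∈ P, ∀ b ∈ (S : Set V) \ VS p n, G.Adj a b → b ∈ P) :
    P = (S : Set V) \ VS p n := by
  by_contra hPne
  obtain ⟨d2, hd2S, hd2⟩ : ∃ d ∈ (S : Set V) \ VS p n, d ∉ P := by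
    by_contra hcon
    push Not at hcon
    exact hPne (Set.Subset.antisymm hP hcon)
  obtain ⟨d1, hd1⟩ := hne
  have hVSS : ∀ v ∈ VS p n, v ∈ S := by
    rintro v ⟨i, hi, rfl⟩
    rcases Nat.lt_or_ge i n with h | h
    · exact (hB.hyp.sup _ _ (hp.adj i h)).1
    · have : i = n := by omega
      subst this
      rw [hp.hn]
      exact (hB.hyp.sup _ _ hp.exy).2
  set T1 := S.filter (fun v => v ∈ VS p n ∨ v ∈ P) with hT1
  set T2 := S.filter (fun v => v ∉ P) with hT2
  have hTu : T1 ∪ T2 = S := by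
    ext v; simp only [hT1, hT2, Finset.mem_union, Finset.mem_filter]; tauto
  have hTi : T1 ∩ T2 = (Finset.range (n + 1)).image p := by
    ext v
    simp only [hT1, hT2, Finset.mem_inter, Finset.mem_filter, Finset.mem_image, Finset.mem_range]
    constructor
    · rintro ⟨⟨-, h1 | h1⟩, -, h2⟩
      · obtain ⟨i, hi, rfl⟩ := h1
        exact ⟨i, by omega, rfl⟩
      · exact absurd h1 h2
    · rintro ⟨i, hi, rfl⟩
      have hv : p i ∈ VS p n := ⟨i, by omega, rfl⟩
      exact ⟨⟨hVSS _ hv, Or.inl hv⟩, hVSS _ hv, fun hh => (hP hh).2 hv⟩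
  have hTc : ((Finset.range (n + 1)).image p).card = n + 1 := by
    rw [Finset.card_image_of_injOn, Finset.card_range]
    intro a ha b hb hab
    simp at ha hb
    exact hp.inj a (by omega) b (by omega) hab
  have hCc : (CE x y p n).card = n + 1 := by
    rw [CE, Finset.card_insert_of_notMem (hp.notMem le_rfl), PE, Finset.card_image_of_injOn]
    · simp
    · intro a ha b hb hab
      simp at ha hb
      exact edge_inj hp.inj (by omega) (by omega) hab
  have hVS2 : ∀ i ≤ n, p i ∈ T1 ∧ p i ∈ T2 := by
    intro i hi
    have : p i ∈ T1 ∩ T2 := by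
      rw [hTi]; exact Finset.mem_image_of_mem _ (by simp; omega)
    exact Finset.mem_inter.1 this
  have hEu : ES (rs G T1) ∪ ES (rs G T2) = ES G := by
    ext e
    induction e with
    | _ a b =>
    rw [Finset.mem_union, mem_ES', mem_ES', mem_ES']
    constructor
    · rintro (h | h) <;> exact h.1
    · intro hab
      have hs := hB.hyp.sup a b hab
      by_cases h1 : a ∈ P
      · left
        refine ⟨hab, by simp [hT1, hs.1, h1], ?_⟩
        by_cases hb : b ∈ VS p n
        · simp [hT1, hs.2, hb]
        · have := hcl a h1 b ⟨hs.2, hb⟩ hab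
          simp [hT1, hs.2, this]
      · by_cases h2 : b ∈ P
        · left
          refine ⟨hab, ?_, by simp [hT1, hs.2, h2]⟩
          by_cases hb : a ∈ VS p n
          · simp [hT1, hs.1, hb]
          · have := hcl b h2 a ⟨hs.1, hb⟩ hab.symm
            simp [hT1, hs.1, this]
        · right
          exact ⟨hab, by simp [hT2, hs.1, h1], by simp [hT2, hs.2, h2]⟩
  have hEi : ES (rs G T1) ∩ ES (rs G T2) = CE x y p n := by
    ext e
    induction e with
    | _ a b =>
    rw [Finset.mem_inter, mem_ES', mem_ES']
    constructor
    · rintro ⟨⟨hab, ha1, hb1⟩, ⟨-, ha2, hb2⟩⟩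
      have ha : a ∈ T1 ∩ T2 := Finset.mem_inter.2 ⟨ha1, ha2⟩
      have hb : b ∈ T1 ∩ T2 := Finset.mem_inter.2 ⟨hb1, hb2⟩
      rw [hTi, Finset.mem_image] at ha hb
      obtain ⟨i, hi, rfl⟩ := ha
      obtain ⟨j, hj, rfl⟩ := hb
      simp at hi hj
      rcases lt_trichotomy i j with h | h | h
      · exact chordless hB hp h (by omega) hab
      · subst h; exact absurd rfl hab.ne
      · rw [Sym2.eq_swap]
        exact chordless hB hp h (by omega) hab.symm
    · intro he
      have key : ∀ a b, s(a, b) ∈ CE x y p n → G.Adj a b ∧ (a ∈ T1 ∧ a ∈ T2) := by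
        intro a b he
        refine ⟨mem_ES'.1 (hp.tight.1 he), ?_⟩
        rcases Finset.mem_insert.1 he with he | he
        · rcases Sym2.eq_iff.1 he with ⟨rfl, rfl⟩ | ⟨rfl, rfl⟩
          · rw [← hp.h0]; exact hVS2 0 (by omega)
          · rw [← hp.hn]; exact hVS2 n (by omega)
        · obtain ⟨t, -, ht, hte⟩ := mem_PE.1 he
          rcases Sym2.eq_iff.1 hte with ⟨rfl, rfl⟩ | ⟨rfl, rfl⟩
          · exact hVS2 t (by omega)
          · exact hVS2 _ ht
      obtain ⟨h1, h2, h3⟩ := key a b he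
      obtain ⟨-, h4, h5⟩ := key b a (by rw [Sym2.eq_swap]; exact he)
      exact ⟨⟨h1, h2, h4⟩, h1, h3, h5⟩
  have hc1 : T1.card < S.card := Finset.card_lt_card (by
    rw [Finset.ssubset_iff_of_subset (Finset.filter_subset _ _)]
    refine ⟨d2, hd2S.1, ?_⟩
    simp [hd2]
    exact fun _ => hd2S.2)
  have hc2 : T2.card < S.card := Finset.card_lt_card (by
    rw [Finset.ssubset_iff_of_subset (Finset.filter_subset _ _)]
    exact ⟨d1, (hP hd1).1, by simp [hT2, hd1]⟩)
  have hyp' : ∀ T : Finset V, CE x y p n ⊆ ES (rs G T) → ES (rs G T) ⊆ ES G → T.card < S.card →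
      EulP (rs G T) T w := by
    intro T h1 h2 h3
    refine hB.ih _ _ _ ?_ ⟨planar_mono (rs_le G _) hB.hyp.pl, fun a b hab => hab.2,
      fun e he => hB.hyp.nn e (h2 he), fun F hF => hB.hyp.cw F (hF.trans h2), hp.tight.2.1.mono h1⟩
    have := Finset.card_le_card h2
    omega
  have i1 := hyp' T1 (hEi ▸ Finset.inter_subset_left) (hEu ▸ Finset.subset_union_left) hc1
  have i2 := hyp' T2 (hEi ▸ Finset.inter_subset_right) (hEu ▸ Finset.subset_union_right) hc2
  have c1 := Finset.card_union_add_card_inter T1 T2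
  have c2 := Finset.card_union_add_card_inter (ES (rs G T1)) (ES (rs G T2))
  have c3 := Finset.sum_union_inter (s₁ := ES (rs G T1)) (s₂ := ES (rs G T2)) (f := w)
  rw [hTu, hTi, hTc] at c1
  rw [hEu, hEi, hCc] at c2
  rw [hEu, hEi, hp.tight.2.2] at c3
  apply hB.bad
  unfold EulP at *
  have c1' : (S.card : ℝ) + (n + 1) = T1.card + T2.card := by exact_mod_cast c1
  have c2' : ((ES G).card : ℝ) + (n + 1) = (ES (rs G T1)).card + (ES (rs G T2)).card := by
    exact_mod_cast c2
  linarith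

end tight

section pair
open scoped Classical
universe u
set_option linter.unusedSectionVars false
variable {V : Type u} [Fintype V]

theorem meet_le {G : SimpleGraph V} {S : Finset V} {w : Sym2 V → ℝ} (hB : Bad G S w)
    {x y : V} {p q : ℕ → V} {n k : ℕ} (hp : TP G w x y p n) (hq : TP G w x y q k) {i j : ℕ}
    (hi : i ≤ n) (hj : j ≤ k) (h : p i = q j) : Ws w q 0 j ≤ Ws w p 0 i := by
  have r1 := rc_PE (p := p) (Nat.zero_le i)
  rw [hp.h0] at r1
  have r2 := rc_PE (p := q) hj
  rw [hq.hn, ← h] at r2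
  have c := hB.cyc (A := PE p 0 i) (B := PE q j k) (hp.sub hi) (hq.sub le_rfl) hp.exy
    (hp.notMem hi) (hq.notMem le_rfl) r1 r2
  rw [sum_PE w hp.inj hi, sum_PE w hq.inj le_rfl] at c
  have := Ws_add w q (Nat.zero_le j) hj
  have := hq.wt
  linarith

theorem meet_eq {G : SimpleGraph V} {S : Finset V} {w : Sym2 V → ℝ} (hB : Bad G S w)
    {x y : V} {p q : ℕ → V} {n k : ℕ} (hp : TP G w x y p n) (hq : TP G w x y q k) {i j : ℕ}
    (hi : i ≤ n) (hj : j ≤ k) (h : p i = q j) : Ws w p 0 i = Ws w q 0 j :=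
  le_antisymm (meet_le hB hq hp hj hi h.symm) (meet_le hB hp hq hi hj h)

theorem diverge {G : SimpleGraph V} {S : Finset V} {w : Sym2 V → ℝ} (hB : Bad G S w)
    {x y : V} {p q : ℕ → V} {n k : ℕ} (hp : TP G w x y p n) (hq : TP G w x y q k) {a i j : ℕ}
    (ha : p a = q a) (ha' : p (a + 1) ≠ q (a + 1)) (hai : a < i)
    (hi : i ≤ n) (haj : a ≤ j) (hj : j ≤ k) (h : p i = q j) : 1 / 2 ≤ Ws w p a i := by
  have r1 := rc_PE (p := q) haj
  rw [← ha] at r1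
  have r2 := (rc_PE (p := p) (show a + 1 ≤ i from hai)).symm
  rw [h] at r2
  have c := hB.cyc (A := PE q a j) (B := PE p (a + 1) i) (hq.sub hj) (hp.sub hi)
    (hp.adj a (by omega)) (by
      intro hh
      obtain ⟨t, h1, h2, h3⟩ := mem_PE.1 hh
      rw [ha] at h3
      rcases Sym2.eq_iff.1 h3 with ⟨h4, h5⟩ | ⟨h4, h5⟩
      · have := hq.inj t (by omega) a (by omega) h4
        subst this
        exact ha' h5.symm
      · have := hq.inj (t + 1) (by omega) a (by omega) h5
        omega) (by
      intro hh
      obtain ⟨t, h1, h2, h3⟩ := mem_PE.1 hh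
      have := edge_inj hp.inj (by omega) (by omega) h3
      omega) r1 r2
  rw [sum_PE w hp.inj hi, sum_PE w hq.inj hj] at c
  have e1 := Ws_add w p (Nat.zero_le a) hai.le
  have e2 := Ws_add w q (Nat.zero_le a) haj
  have e3 := meet_eq hB hp hq (by omega) (by omega) ha
  have e4 := meet_eq hB hp hq hi hj h
  have e5 := Ws_add w p (show a ≤ a + 1 by omega) (show a + 1 ≤ i from hai)
  have e6 : Ws w p a (a + 1) = w s(p a, p (a + 1)) := by simp [Ws]
  linarith

theorem exists_prefix {G : SimpleGraph V} {w : Sym2 V → ℝ}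
    {x y : V} {p q : ℕ → V} {n k : ℕ} (hp : TP G w x y p n) (hq : TP G w x y q k)
    (hne : ¬ (n = k ∧ ∀ t ≤ n, p t = q t)) :
    ∃ a, a < n ∧ a < k ∧ (∀ t ≤ a, p t = q t) ∧ p (a + 1) ≠ q (a + 1) := by
  by_cases hex : ∃ t, t ≤ n ∧ t ≤ k ∧ p t ≠ q t
  · have hs := Nat.find_spec hex
    have hm := fun {m} => Nat.find_min (m := m) hex
    set m := Nat.find hex with hmdef
    have hm0 : m ≠ 0 := by
      intro h0
      rw [h0, hp.h0, hq.h0] at hs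
      exact hs.2.2 rfl
    refine ⟨m - 1, by omega, by omega, ?_, ?_⟩
    · intro t ht
      by_contra hcon
      exact hm (show t < m by omega) ⟨by omega, by omega, hcon⟩
    · rw [show m - 1 + 1 = m by omega]
      exact hs.2.2
  · push Not at hex
    exfalso
    apply hne
    have hnk : n = k := by
      rcases le_total n k with h | h
      · have h1 := hex n le_rfl h
        rw [hp.hn, ← hq.hn] at h1
        exact (hq.inj _ le_rfl _ h h1).symm
      · have h1 := hex k h le_rfl
        rw [hq.hn, ← hp.hn] at h1
        exact (hp.inj _ h _ le_rfl h1).symm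
    exact ⟨hnk, fun t ht => hex t ht (by omega)⟩

/-- Relative position of two tight paths. -/
structure PR (p : ℕ → V) (n : ℕ) (q : ℕ → V) (k a b : ℕ) : Prop where
  hn : a + b + 2 ≤ n
  hk : a + b + 2 ≤ k
  pre : ∀ t ≤ a, p t = q t
  suf : ∀ t ≤ b, p (n - t) = q (k - t)
  mp : ∀ i, a < i → i + b < n → ∀ j ≤ k, p i ≠ q j
  mq : ∀ j, a < j → j + b < k → ∀ i ≤ n, p i ≠ q j

theorem PR.symm {p q : ℕ → V} {n k a b : ℕ} (h : PR p n q k a b) : PR q k p n a b :=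
  ⟨h.hk, h.hn, fun t ht => (h.pre t ht).symm, fun t ht => (h.suf t ht).symm,
    fun j h1 h2 i hi => (h.mq j h1 h2 i hi).symm, fun j h1 h2 i hi => (h.mp j h1 h2 i hi).symm⟩

theorem PR.rev {p q : ℕ → V} {n k a b : ℕ} (h : PR p n q k a b) :
    PR (fun i => p (n - i)) n (fun i => q (k - i)) k b a := by
  refine ⟨by have := h.hn; omega, by have := h.hk; omega, h.suf, ?_, ?_, ?_⟩
  · intro t ht
    have h1 := h.hn
    have h2 := h.hk
    beta_reduce
    rw [show n - (n - t) = t by omega, show k - (k - t) = t by omega]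
    exact h.pre t ht
  · intro i h1 h2 j hj
    exact h.mp (n - i) (by omega) (by omega) (k - j) (by omega)
  · intro i h1 h2 j hj
    exact h.mq (k - i) (by omega) (by omega) (n - j) (by omega)

theorem Ws_pos_aux {G : SimpleGraph V} {S : Finset V} {w : Sym2 V → ℝ} (hB : Bad G S w)
    {x y : V} {p : ℕ → V} {n : ℕ} (hp : TP G w x y p n) {i j : ℕ} (hj : j ≤ n) :
    0 ≤ Ws w p i j := by
  unfold Ws
  refine Finset.sum_nonneg (fun t ht => ?_)
  simp at ht
  exact (hB.pos (mem_ES'.2 (hp.adj t (by omega)))).le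

theorem PR_half {G : SimpleGraph V} {S : Finset V} {w : Sym2 V → ℝ} (hB : Bad G S w)
    {x y : V} {p q : ℕ → V} {n k : ℕ} (hp : TP G w x y p n) (hq : TP G w x y q k)
    (hne : ¬ (n = k ∧ ∀ t ≤ n, p t = q t)) {a b : ℕ} (ha : a < n) (ha' : a < k)
    (hpre : ∀ t ≤ a, p t = q t) (hdiv : p (a + 1) ≠ q (a + 1))
    (hb : b < n) (hb' : b < k) (hsuf : ∀ t ≤ b, p (n - t) = q (k - t))
    (hdiv' : p (n - (b + 1)) ≠ q (k - (b + 1))) :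
    a + b + 2 ≤ n ∧ ∀ i, a < i → i + b < n → ∀ j ≤ k, p i ≠ q j := by
  have key : ∀ i j, a < i → i ≤ n → j ≤ k → p i = q j → 1 / 2 ≤ Ws w p a i := by
    intro i j h1 h2 h3 h4
    refine diverge hB hp hq (hpre a le_rfl) hdiv h1 h2 ?_ h3 h4
    by_contra hlt
    have := hpre j (by omega)
    have := hp.inj i h2 j (by omega) (h4.trans this.symm)
    omega
  refine ⟨?_, ?_⟩
  · have hab : a < n - b := by
      by_contra hcon
      have h1 := hpre (n - b) (by omega)
      have h2 := hsuf b le_rfl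
      have h3 := hq.inj (n - b) (by omega) (k - b) (by omega) (h1.symm.trans h2)
      apply hne
      refine ⟨by omega, fun t ht => ?_⟩
      by_cases hta : t ≤ a
      · exact hpre t hta
      · have := hsuf (n - t) (by omega)
        rwa [show n - (n - t) = t by omega, show k - (n - t) = t by omega] at this
    have h1 := key (n - b) (k - b) hab (by omega) (by omega) (hsuf b le_rfl)
    by_contra hcon
    have h2 : n - b = a + 1 := by omega
    rw [h2] at h1
    have h3 : Ws w p a (a + 1) = w s(p a, p (a + 1)) := by simp [Ws]
    have := hB.half (mem_ES'.2 (hp.adj a ha))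
    linarith
  · intro i h1 h2 j hj hij
    have k1 := key i j h1 (by omega) hj hij
    have k2 := diverge hB hp.rev hq.rev (a := b) (i := n - i) (j := k - j) (hsuf b le_rfl) hdiv'
      (by omega) (by omega) (by
        by_contra hlt
        have := hsuf (k - j) (by omega)
        rw [show k - (k - j) = j by omega, ← hij] at this
        have := hp.inj _ (by omega) _ (by omega) this
        omega) (by omega) (by
        beta_reduce
        rw [show n - (n - i) = i by omega, show k - (k - j) = j by omega]
        exact hij)
    rw [Ws_rev w p n (by omega) (by omega), show n - (n - i) = i by omega] at k2
    have e1 := Ws_add w p (show 0 ≤ a by omega) h1.le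
    have e2 := Ws_add w p (show 0 ≤ i by omega) (show i ≤ n - b by omega)
    have e3 := Ws_add w p (show 0 ≤ n - b by omega) (show n - b ≤ n by omega)
    have e4 := Ws_pos_aux hB hp (i := 0) (j := a) (by omega)
    have e5 := Ws_pos_aux hB hp (i := n - b) (j := n) (by omega)
    have e6 := hp.wt
    have e7 := hB.pos (mem_ES'.2 hp.exy)
    linarith

theorem exists_PR {G : SimpleGraph V} {S : Finset V} {w : Sym2 V → ℝ} (hB : Bad G S w)
    {x y : V} {p q : ℕ → V} {n k : ℕ} (hp : TP G w x y p n) (hq : TP G w x y q k)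
    (hne : ¬ (n = k ∧ ∀ t ≤ n, p t = q t)) : ∃ a b, PR p n q k a b := by
  have hne' : ¬ (k = n ∧ ∀ t ≤ k, q t = p t) := by
    rintro ⟨rfl, h⟩
    exact hne ⟨rfl, fun t ht => (h t ht).symm⟩
  have hner : ¬ (n = k ∧ ∀ t ≤ n, p (n - t) = q (k - t)) := by
    rintro ⟨rfl, h⟩
    refine hne ⟨rfl, fun t ht => ?_⟩
    have := h (n - t) (by omega)
    rwa [show n - (n - t) = t by omega] at this
  obtain ⟨a, ha, ha', hpre, hdiv⟩ := exists_prefix hp hq hne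
  obtain ⟨b, hb, hb', hsuf, hdiv'⟩ := exists_prefix hp.rev hq.rev hner
  have h1 := PR_half hB hp hq hne ha ha' hpre hdiv hb hb' hsuf hdiv'
  have h2 := PR_half hB hq hp hne' ha' ha (fun t ht => (hpre t ht).symm) hdiv.symm hb' hb
    (fun t ht => (hsuf t ht).symm) hdiv'.symm
  exact ⟨a, b, h1.1, h2.1, hpre, hsuf, h1.2, fun j h3 h4 i hi => (h2.2 j h3 h4 i hi).symm⟩

theorem PR.div {p q : ℕ → V} {n k a b : ℕ} (h : PR p n q k a b) : p (a + 1) ≠ q (a + 1) :=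
  h.mp (a + 1) (by omega) (by have := h.hn; omega) _ (by have := h.hk; omega)

theorem PR.ultra {p q r : ℕ → V} {n k l a b a' b' a'' b'' : ℕ} (h : PR p n q k a b)
    (h' : PR p n r l a' b') (h'' : PR q k r l a'' b'') (hlt : a < a') : a'' = a := by
  rcases lt_trichotomy a'' a with h1 | h1 | h1
  · exact absurd ((h.pre _ h1).symm.trans (h'.pre _ (by omega))) h''.div
  · exact h1
  · exact absurd ((h'.pre _ hlt).trans (h''.pre _ h1).symm) h.div

end pair

section triple
open scoped Classical
universe u
set_option linter.unusedSectionVars false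
variable {V : Type u} [Fintype V]

theorem no_K33_lt {G : SimpleGraph V} (hG : IsPlanar G) (f h : Fin 3 → Set V)
    (hf : ∀ i, Cn G (f i)) (hh : ∀ i, Cn G (h i))
    (dff : ∀ i j, i < j → Disjoint (f i) (f j))
    (dhh : ∀ i j, i < j → Disjoint (h i) (h j))
    (dfh : ∀ i j, Disjoint (f i) (h j))
    (adj : ∀ i j, Tch G (f i) (h j)) : False := by
  refine no_K33 hG f h hf hh ?_ ?_ dfh adj
  · intro i j hij
    rcases lt_or_gt_of_ne hij with h | h
    · exact dff i j h
    · exact (dff j i h).symm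
  · intro i j hij
    rcases lt_or_gt_of_ne hij with h | h
    · exact dhh i j h
    · exact (dhh j i h).symm

/-- Segment of a path. -/
def Seg (p : ℕ → V) (i j : ℕ) : Set V := {v | ∃ t, i ≤ t ∧ t ≤ j ∧ p t = v}

theorem mem_seg {p : ℕ → V} {i j t : ℕ} (h1 : i ≤ t) (h2 : t ≤ j) : p t ∈ Seg p i j :=
  ⟨t, h1, h2, rfl⟩

theorem TP.cn {G : SimpleGraph V} {w : Sym2 V → ℝ} {x y : V} {p : ℕ → V} {n : ℕ}
    (h : TP G w x y p n) {i j : ℕ} (hij : i ≤ j) (hj : j ≤ n) : Cn G (Seg p i j) := by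
  induction j, hij using Nat.le_induction with
  | base =>
    have : Seg p i i = {p i} := by
      ext v
      constructor
      · rintro ⟨t, h1, h2, rfl⟩
        have : t = i := by omega
        rw [this]; rfl
      · rintro rfl; exact mem_seg le_rfl le_rfl
    rw [this]
    exact cn_singleton _ _
  | succ j hij ih =>
    have : Seg p i (j + 1) = Seg p i j ∪ {p (j + 1)} := by
      ext v
      constructor
      · rintro ⟨t, h1, h2, rfl⟩
        rcases Nat.lt_or_ge j t with h3 | h3
        · have : t = j + 1 := by omega
          rw [this]; right; rfl
        · left; exact mem_seg h1 h3
      · rintro (⟨t, h1, h2, rfl⟩ | rfl)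
        · exact mem_seg h1 (by omega)
        · exact mem_seg (by omega) le_rfl
    rw [this]
    exact (ih (by omega)).union (cn_singleton _ _)
      ⟨p j, mem_seg hij le_rfl, _, rfl, h.adj j (by omega)⟩

theorem TP.mem_S {G : SimpleGraph V} {S : Finset V} {w : Sym2 V → ℝ} (hB : Bad G S w)
    {x y : V} {p : ℕ → V} {n : ℕ} (hp : TP G w x y p n) {i : ℕ} (hi : i ≤ n) : p i ∈ S := by
  rcases Nat.lt_or_ge i n with h | h
  · exact (hB.hyp.sup _ _ (hp.adj i h)).1
  · have : i = n := by omega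
    subst this
    rw [hp.hn]
    exact (hB.hyp.sup _ _ hp.exy).2

theorem seg_disj_self {p : ℕ → V} {n : ℕ} (inj : ∀ i ≤ n, ∀ j ≤ n, p i = p j → i = j)
    {i j i' j' : ℕ} (hj' : j' ≤ n) (h : j < i') : Disjoint (Seg p i j) (Seg p i' j') := by
  rw [Set.disjoint_left]
  rintro v ⟨s, h1, h2, rfl⟩ ⟨t, h3, h4, h5⟩
  have := inj t (by omega) s (by omega) h5
  omega

theorem PR.meet {p q : ℕ → V} {n k a b : ℕ} (h : PR p n q k a b)
    (inj : ∀ i ≤ k, ∀ j ≤ k, q i = q j → i = j) {s t : ℕ} (hs : s ≤ n) (ht : t ≤ k)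
    (hst : p s = q t) : (s = t ∧ s ≤ a) ∨ (s + k = t + n ∧ n ≤ s + b) := by
  have h1 := h.hn
  have h2 := h.hk
  by_cases hsa : s ≤ a
  · left
    exact ⟨inj _ (by omega) _ ht ((h.pre s hsa).symm.trans hst), hsa⟩
  · by_cases hsb : n ≤ s + b
    · right
      have h3 := h.suf (n - s) (by omega)
      rw [show n - (n - s) = s by omega, hst] at h3
      have := inj _ ht _ (by omega) h3
      omega
    · exact absurd hst (h.mp s (by omega) (by omega) t ht)

theorem PR.mid {p q : ℕ → V} {n k a b : ℕ} (h : PR p n q k a b) {t : ℕ} (ht : t ≤ n)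
    (hn : p t ∉ VS q k) : a < t ∧ t + b < n := by
  have h1 := h.hn
  have h2 := h.hk
  constructor
  · by_contra hcon
    exact hn ⟨t, by omega, (h.pre t (by omega)).symm⟩
  · by_contra hcon
    have h3 := h.suf (n - t) (by omega)
    rw [show n - (n - t) = t by omega] at h3
    exact hn ⟨_, by omega, h3.symm⟩

theorem L3_touch {G : SimpleGraph V} {S : Finset V} {w : Sym2 V → ℝ} (hB : Bad G S w)
    {x y : V} {p : ℕ → V} {n : ℕ} (hp : TP G w x y p n) {N Q : Set V}
    (hN : N ⊆ (S : Set V) \ VS p n) (hne : N.Nonempty)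
    (hQ : Q ⊆ (S : Set V) \ VS p n) (hQne : Q.Nonempty) (hd : Disjoint N Q)
    (hcl : ∀ a ∈ N, ∀ b ∈ (S : Set V) \ VS p n, G.Adj a b → b ∈ N ∨ b ∈ Q) : Tch G N Q := by
  by_contra ht
  have := L3 hB hp hN hne (fun a ha b hb hab => (hcl a ha b hb hab).resolve_right
    (fun hbQ => ht ⟨a, ha, b, hbQ, hab⟩))
  obtain ⟨q, hq⟩ := hQne
  have hq' := hQ hq
  rw [← this] at hq'
  exact Set.disjoint_left.1 hd hq' hq

theorem caseA {G : SimpleGraph V} {S : Finset V} {w : Sym2 V → ℝ} (hB : Bad G S w)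
    {x y : V} {p1 p2 p3 : ℕ → V} {n1 n2 n3 a b a' b' : ℕ} (h1 : TP G w x y p1 n1)
    (h2 : TP G w x y p2 n2) (h3 : TP G w x y p3 n3) (r12 : PR p1 n1 p2 n2 a b)
    (r13 : PR p1 n1 p3 n3 a b) (r23 : PR p2 n2 p3 n3 a' b') (ha : a < a') : False := by
  have e1 := r12.hn
  have e2 := r23.hn
  have e3 := r23.hk
  set D : Set V := (S : Set V) \ (VS p2 n2 ∪ VS p3 n3) with hD
  have hQ1D : Seg p1 (a + 1) (n1 - b - 1) ⊆ D := by
    rintro v ⟨t, t1, t2, rfl⟩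
    refine ⟨h1.mem_S hB (by omega), ?_⟩
    rintro (⟨s, s1, s2⟩ | ⟨s, s1, s2⟩)
    · exact r12.mp t (by omega) (by omega) s s1 s2.symm
    · exact r13.mp t (by omega) (by omega) s s1 s2.symm
  obtain ⟨N, hN, hQN, hND, hNcl⟩ := exists_comp G (h1.cn (i := a + 1) (j := n1 - b - 1)
    (by omega) (by omega)) hQ1D
  have dN2 : ∀ i j, j ≤ n2 → Disjoint N (Seg p2 i j) := by
    intro i j hj
    rw [Set.disjoint_left]
    rintro v hv ⟨t, t1, t2, rfl⟩
    exact (hND hv).2 (Or.inl ⟨t, by omega, rfl⟩)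
  have dN3 : ∀ i j, j ≤ n3 → Disjoint N (Seg p3 i j) := by
    intro i j hj
    rw [Set.disjoint_left]
    rintro v hv ⟨t, t1, t2, rfl⟩
    exact (hND hv).2 (Or.inr ⟨t, by omega, rfl⟩)
  have tN2 : Tch G N (Seg p2 (a' + 1) (n2 - b' - 1)) := by
    refine L3_touch hB h3 ?_ hN.1 ?_ (h2.cn (by omega) (by omega)).1 (dN2 _ _ (by omega)) ?_
    · intro v hv
      exact ⟨(hND hv).1, fun hh => (hND hv).2 (Or.inr hh)⟩
    · rintro v ⟨t, t1, t2, rfl⟩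
      refine ⟨h2.mem_S hB (by omega), ?_⟩
      rintro ⟨s, s1, s2⟩
      exact r23.mp t (by omega) (by omega) s s1 s2.symm
    · intro u hu v hv huv
      by_cases hv2 : v ∈ VS p2 n2
      · right
        obtain ⟨t, t1, rfl⟩ := hv2
        have := r23.mid t1 hv.2
        exact mem_seg (by omega) (by omega)
      · left
        exact hNcl u hu v ⟨hv.1, fun hh => hh.elim hv2 hv.2⟩ huv
  have tN3 : Tch G N (Seg p3 (a' + 1) (n3 - b' - 1)) := by
    refine L3_touch hB h2 ?_ hN.1 ?_ (h3.cn (by omega) (by omega)).1 (dN3 _ _ (by omega)) ?_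
    · intro v hv
      exact ⟨(hND hv).1, fun hh => (hND hv).2 (Or.inl hh)⟩
    · rintro v ⟨t, t1, t2, rfl⟩
      refine ⟨h3.mem_S hB (by omega), ?_⟩
      rintro ⟨s, s1, s2⟩
      exact r23.mq t (by omega) (by omega) s s1 s2
    · intro u hu v hv huv
      by_cases hv2 : v ∈ VS p3 n3
      · right
        obtain ⟨t, t1, rfl⟩ := hv2
        have := r23.symm.mid t1 hv.2
        exact mem_seg (by omega) (by omega)
      · left
        exact hNcl u hu v ⟨hv.1, fun hh => hh.elim hv.2 hv2⟩ huv
  have dQ : ∀ i j, j ≤ n2 → Disjoint (Seg p2 i j) (Seg p3 (a' + 1) (n3 - b' - 1)) := by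
    intro i j hj
    rw [Set.disjoint_left]
    rintro v ⟨s, s1, s2, rfl⟩ ⟨t, t1, t2, t3⟩
    exact r23.mq t (by omega) (by omega) s (by omega) t3.symm
  refine no_K33_lt hB.hyp.pl ![Seg p2 (a + 1) a', N, Seg p2 (n2 - b') n2]
    ![Seg p2 0 a, Seg p2 (a' + 1) (n2 - b' - 1), Seg p3 (a' + 1) (n3 - b' - 1)] ?_ ?_ ?_ ?_ ?_ ?_
  · intro i
    fin_cases i
    · exact h2.cn (by omega) (by omega)
    · exact hN
    · exact h2.cn (by omega) (by omega)
  · intro i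
    fin_cases i
    · exact h2.cn (by omega) (by omega)
    · exact h2.cn (by omega) (by omega)
    · exact h3.cn (by omega) (by omega)
  · intro i j hij
    fin_cases i <;> fin_cases j <;> first | exact absurd hij (by decide) | skip
    · exact (dN2 _ _ (by omega)).symm
    · exact seg_disj_self h2.inj (by omega) (by omega)
    · exact dN2 _ _ (by omega)
  · intro i j hij
    fin_cases i <;> fin_cases j <;> first | exact absurd hij (by decide) | skip
    · exact seg_disj_self h2.inj (by omega) (by omega)
    · exact dQ _ _ (by omega)
    · exact dQ _ _ (by omega)
  · intro i j
    fin_cases i <;> fin_cases j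
    · exact (seg_disj_self h2.inj (by omega) (by omega)).symm
    · exact seg_disj_self h2.inj (by omega) (by omega)
    · exact dQ _ _ (by omega)
    · exact dN2 _ _ (by omega)
    · exact dN2 _ _ (by omega)
    · exact dN3 _ _ (by omega)
    · exact (seg_disj_self h2.inj (by omega) (by omega)).symm
    · exact (seg_disj_self h2.inj (by omega) (by omega)).symm
    · exact dQ _ _ (by omega)
  · intro i j
    fin_cases i <;> fin_cases j
    · exact ⟨_, mem_seg (t := a + 1) (by omega) (by omega), _, mem_seg (t := a) (by omega)
        (by omega), (h2.adj a (by omega)).symm⟩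
    · exact ⟨_, mem_seg (t := a') (by omega) (by omega), _, mem_seg (t := a' + 1) (by omega)
        (by omega), h2.adj a' (by omega)⟩
    · exact ⟨_, mem_seg (t := a') (by omega) (by omega), _, mem_seg (t := a' + 1) (by omega)
        (by omega), by rw [r23.pre a' le_rfl]; exact h3.adj a' (by omega)⟩
    · exact ⟨_, hQN (mem_seg (t := a + 1) (by omega) (by omega)), _, mem_seg (t := a) (by omega)
        (by omega), by rw [← r12.pre a le_rfl]; exact (h1.adj a (by omega)).symm⟩
    · exact tN2
    · exact tN3
    · exact ⟨_, mem_seg (t := n2) (by omega) (by omega), _, mem_seg (t := 0) (by omega)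
        (by omega), by rw [h2.hn, h2.h0]; exact h2.exy.symm⟩
    · refine ⟨_, mem_seg (t := n2 - b') (by omega) (by omega), _, mem_seg (t := n2 - b' - 1)
        (by omega) (by omega), ?_⟩
      have := h2.adj (n2 - b' - 1) (by omega)
      rw [show n2 - b' - 1 + 1 = n2 - b' by omega] at this
      exact this.symm
    · refine ⟨_, mem_seg (t := n2 - b') (by omega) (by omega), _, mem_seg (t := n3 - b' - 1)
        (by omega) (by omega), ?_⟩
      have := h3.adj (n3 - b' - 1) (by omega)
      rw [show n3 - b' - 1 + 1 = n3 - b' by omega, ← r23.suf b' le_rfl] at this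
      exact this.symm

end triple

section triple2
open scoped Classical
universe u
set_option linter.unusedSectionVars false
variable {V : Type u} [Fintype V]

theorem caseC {G : SimpleGraph V} {S : Finset V} {w : Sym2 V → ℝ} (hB : Bad G S w)
    {x y : V} {p1 p2 p3 : ℕ → V} {n1 n2 n3 a b a' b' : ℕ} (h1 : TP G w x y p1 n1)
    (h2 : TP G w x y p2 n2) (h3 : TP G w x y p3 n3) (r12 : PR p1 n1 p2 n2 a b)
    (r13 : PR p1 n1 p3 n3 a b') (r23 : PR p2 n2 p3 n3 a' b) (ha : a < a') (hb : b < b') :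
    False := by
  have e1 := r12.hn
  have e2 := r23.hn
  have e3 := r23.hk
  have e4 := r13.hn
  have e5 := r13.hk
  have e6 : a' < n3 - b' := by
    by_contra hcon
    have q1 := r13.suf (n3 - a') (by omega)
    rw [show n3 - (n3 - a') = a' by omega, ← r23.pre a' le_rfl] at q1
    exact r12.mq a' ha (by omega) _ (by omega) q1
  set Q2 := Seg p2 (a' + 1) (n2 - b - 1) with hQ2
  set D : Set V := ((S : Set V) \ VS p3 n3) \ Q2 with hD
  have hQ1D : Seg p1 (a + 1) (n1 - b' - 1) ⊆ D := by
    rintro v ⟨t, t1, t2, rfl⟩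
    refine ⟨⟨h1.mem_S hB (by omega), ?_⟩, ?_⟩
    · rintro ⟨s, s1, s2⟩
      exact r13.mp t (by omega) (by omega) s s1 s2.symm
    · rintro ⟨s, s1, s2, s3⟩
      exact r12.mp t (by omega) (by omega) s (by omega) s3.symm
  obtain ⟨N, hN, hQN, hND, hNcl⟩ := exists_comp G (h1.cn (i := a + 1) (j := n1 - b' - 1)
    (by omega) (by omega)) hQ1D
  have dNQ : Disjoint N Q2 := by
    rw [Set.disjoint_left]
    intro v hv hv'
    exact (hND hv).2 hv'
  have dN3 : ∀ i j, j ≤ n3 → Disjoint N (Seg p3 i j) := by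
    intro i j hj
    rw [Set.disjoint_left]
    rintro v hv ⟨t, t1, t2, rfl⟩
    exact (hND hv).1.2 ⟨t, by omega, rfl⟩
  have tN2 : Tch G N Q2 := by
    refine L3_touch hB h3 ?_ hN.1 ?_ (h2.cn (by omega) (by omega)).1 dNQ ?_
    · intro v hv
      exact (hND hv).1
    · rintro v ⟨t, t1, t2, rfl⟩
      refine ⟨h2.mem_S hB (by omega), ?_⟩
      rintro ⟨s, s1, s2⟩
      exact r23.mp t (by omega) (by omega) s s1 s2.symm
    · intro u hu v hv huv
      by_cases hv2 : v ∈ Q2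
      · exact Or.inr hv2
      · exact Or.inl (hNcl u hu v ⟨hv, hv2⟩ huv)
  have dQ : ∀ i j, j ≤ n3 → Disjoint Q2 (Seg p3 i j) := by
    intro i j hj
    rw [Set.disjoint_left]
    rintro v ⟨s, s1, s2, rfl⟩ ⟨t, t1, t2, t3⟩
    exact r23.mp s (by omega) (by omega) t (by omega) t3.symm
  refine no_K33_lt hB.hyp.pl ![Seg p3 0 a, Q2, Seg p3 (n3 - b') (n3 - b - 1)]
    ![N, Seg p3 (a + 1) (n3 - b' - 1), Seg p3 (n3 - b) n3] ?_ ?_ ?_ ?_ ?_ ?_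
  · intro i
    fin_cases i
    · exact h3.cn (by omega) (by omega)
    · exact h2.cn (by omega) (by omega)
    · exact h3.cn (by omega) (by omega)
  · intro i
    fin_cases i
    · exact hN
    · exact h3.cn (by omega) (by omega)
    · exact h3.cn (by omega) (by omega)
  · intro i j hij
    fin_cases i <;> fin_cases j <;> first | exact absurd hij (by decide) | skip
    · exact (dQ _ _ (by omega)).symm
    · exact seg_disj_self h3.inj (by omega) (by omega)
    · exact dQ _ _ (by omega)
  · intro i j hij
    fin_cases i <;> fin_cases j <;> first | exact absurd hij (by decide) | skip
    · exact dN3 _ _ (by omega)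
    · exact dN3 _ _ (by omega)
    · exact seg_disj_self h3.inj (by omega) (by omega)
  · intro i j
    fin_cases i <;> fin_cases j
    · exact (dN3 _ _ (by omega)).symm
    · exact seg_disj_self h3.inj (by omega) (by omega)
    · exact seg_disj_self h3.inj (by omega) (by omega)
    · exact dNQ.symm
    · exact dQ _ _ (by omega)
    · exact dQ _ _ (by omega)
    · exact (dN3 _ _ (by omega)).symm
    · exact (seg_disj_self h3.inj (by omega) (by omega)).symm
    · exact seg_disj_self h3.inj (by omega) (by omega)
  · intro i j
    fin_cases i <;> fin_cases j
    · exact ⟨_, mem_seg (t := a) (by omega) (by omega), _,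
        hQN (mem_seg (t := a + 1) (by omega) (by omega)),
        by rw [← r13.pre a le_rfl]; exact h1.adj a (by omega)⟩
    · exact ⟨_, mem_seg (t := a) (by omega) (by omega), _, mem_seg (t := a + 1) (by omega)
        (by omega), h3.adj a (by omega)⟩
    · exact ⟨_, mem_seg (t := 0) (by omega) (by omega), _, mem_seg (t := n3) (by omega)
        (by omega), by rw [h3.hn, h3.h0]; exact h3.exy⟩
    · exact tN2.symm
    · exact ⟨_, mem_seg (t := a' + 1) (by omega) (by omega), _, mem_seg (t := a') (by omega)
        (by omega), by rw [← r23.pre a' le_rfl]; exact (h2.adj a' (by omega)).symm⟩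
    · refine ⟨_, mem_seg (t := n2 - b - 1) (by omega) (by omega), _, mem_seg (t := n3 - b)
        (by omega) (by omega), ?_⟩
      have := h2.adj (n2 - b - 1) (by omega)
      rw [show n2 - b - 1 + 1 = n2 - b by omega, r23.suf b le_rfl] at this
      exact this
    · refine ⟨_, mem_seg (t := n3 - b') (by omega) (by omega), _,
        hQN (mem_seg (t := n1 - b' - 1) (by omega) (by omega)), ?_⟩
      have := h1.adj (n1 - b' - 1) (by omega)
      rw [show n1 - b' - 1 + 1 = n1 - b' by omega, r13.suf b' le_rfl] at this
      exact this.symm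
    · refine ⟨_, mem_seg (t := n3 - b') (by omega) (by omega), _, mem_seg (t := n3 - b' - 1)
        (by omega) (by omega), ?_⟩
      have := h3.adj (n3 - b' - 1) (by omega)
      rw [show n3 - b' - 1 + 1 = n3 - b' by omega] at this
      exact this.symm
    · refine ⟨_, mem_seg (t := n3 - b - 1) (by omega) (by omega), _, mem_seg (t := n3 - b)
        (by omega) (by omega), ?_⟩
      have := h3.adj (n3 - b - 1) (by omega)
      rw [show n3 - b - 1 + 1 = n3 - b by omega] at this
      exact this

theorem PR.tchA {G : SimpleGraph V} {w : Sym2 V → ℝ} {x y : V} {p q : ℕ → V} {n k a b : ℕ}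
    (hq : TP G w x y q k) (r : PR p n q k a b) :
    Tch G (Seg p 0 a) (Seg q (a + 1) (k - b - 1)) := by
  have e1 := r.hk
  exact ⟨_, mem_seg (t := a) (by omega) (by omega), _, mem_seg (t := a + 1) (by omega)
        (by omega), by rw [r.pre a le_rfl]; exact hq.adj a (by omega)⟩

theorem PR.tchB {G : SimpleGraph V} {w : Sym2 V → ℝ} {x y : V} {p q : ℕ → V} {n k a b : ℕ}
    (hq : TP G w x y q k) (r : PR p n q k a b) :
    Tch G (Seg p (n - b) n) (Seg q (a + 1) (k - b - 1)) := by
  have e1 := r.hk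
  refine ⟨_, mem_seg (t := n - b) (by omega) (by omega), _, mem_seg (t := k - b - 1)
    (by omega) (by omega), ?_⟩
  have := hq.adj (k - b - 1) (by omega)
  rw [show k - b - 1 + 1 = k - b by omega, ← r.suf b le_rfl] at this
  exact this.symm

theorem PR.dis {p q : ℕ → V} {n k a b : ℕ} (r : PR p n q k a b) {i j : ℕ} (hj : j ≤ n) :
    Disjoint (Seg p i j) (Seg q (a + 1) (k - b - 1)) := by
  have e1 := r.hk
  rw [Set.disjoint_left]
  rintro v ⟨s, s1, s2, rfl⟩ ⟨t, t1, t2, t3⟩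
  exact r.mq t (by omega) (by omega) s (by omega) t3.symm

theorem PR.out {G : SimpleGraph V} {S : Finset V} {w : Sym2 V → ℝ} (hB : Bad G S w) {x y : V}
    {p q : ℕ → V} {n k a b : ℕ} (hq : TP G w x y q k) (r : PR p n q k a b) :
    Seg q (a + 1) (k - b - 1) ⊆ (S : Set V) \ VS p n := by
  have e1 := r.hk
  rintro v ⟨t, t1, t2, rfl⟩
  refine ⟨hq.mem_S hB (by omega), ?_⟩
  rintro ⟨s, s1, s2⟩
  exact r.mq t (by omega) (by omega) s s1 s2

/-- In case I, the closed component `N` of `Q2` in `Q2 ∪ U` touches `Q3` since `S \ V1` is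
connected. -/
theorem caseI_touch {G : SimpleGraph V} {S : Finset V} {w : Sym2 V → ℝ} (hB : Bad G S w)
    {x y : V} {p1 p2 p3 : ℕ → V} {n1 n2 n3 a b : ℕ} (h1 : TP G w x y p1 n1)
    (h2 : TP G w x y p2 n2) (h3 : TP G w x y p3 n3) (r12 : PR p1 n1 p2 n2 a b)
    (r13 : PR p1 n1 p3 n3 a b) (r23 : PR p2 n2 p3 n3 a b) {U N : Set V}
    (hU : ∀ v, v ∈ U ↔ v ∈ S ∧ v ∉ VS p1 n1 ∧ v ∉ VS p2 n2 ∧ v ∉ VS p3 n3)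
    (hN : N ⊆ Seg p2 (a + 1) (n2 - b - 1) ∪ U) (hN' : N.Nonempty)
    (hcl : ∀ s ∈ N, ∀ t ∈ Seg p2 (a + 1) (n2 - b - 1) ∪ U, G.Adj s t → t ∈ N) :
    Tch G N (Seg p3 (a + 1) (n3 - b - 1)) := by
  have e1 := r12.hn
  have e2 := r23.hn
  have e3 := r23.hk
  refine L3_touch hB h1 ?_ hN' (r13.out hB h3) (h3.cn (by omega) (by omega)).1 ?_ ?_
  · intro v hv
    rcases hN hv with h | h
    · exact r12.out hB h2 h
    · exact ⟨((hU v).1 h).1, ((hU v).1 h).2.1⟩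
  · rw [Set.disjoint_left]
    intro v hv hv'
    rcases hN hv with h | h
    · exact Set.disjoint_left.1 (r23.dis (by omega)) h hv'
    · obtain ⟨t, t1, t2, rfl⟩ := hv'
      exact ((hU _).1 h).2.2.2 ⟨t, by omega, rfl⟩
  · intro s hs v hv hsv
    by_cases v2 : v ∈ VS p2 n2
    · left
      obtain ⟨t, t1, rfl⟩ := v2
      have := r12.symm.mid t1 hv.2
      exact hcl s hs _ (Or.inl (mem_seg (by omega) (by omega))) hsv
    · by_cases v3 : v ∈ VS p3 n3
      · right
        obtain ⟨t, t1, rfl⟩ := v3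
        have := r13.symm.mid t1 hv.2
        exact mem_seg (by omega) (by omega)
      · left
        exact hcl s hs _ (Or.inr ((hU v).2 ⟨hv.1, hv.2, v2, v3⟩)) hsv

theorem caseI {G : SimpleGraph V} {S : Finset V} {w : Sym2 V → ℝ} (hB : Bad G S w)
    {x y : V} {p1 p2 p3 : ℕ → V} {n1 n2 n3 a b : ℕ} (h1 : TP G w x y p1 n1)
    (h2 : TP G w x y p2 n2) (h3 : TP G w x y p3 n3) (r12 : PR p1 n1 p2 n2 a b)
    (r13 : PR p1 n1 p3 n3 a b) (r23 : PR p2 n2 p3 n3 a b) : False := by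
  have e1 := r12.hn
  have e2 := r23.hn
  have e3 := r23.hk
  set U : Set V := {v | v ∈ S ∧ v ∉ VS p1 n1 ∧ v ∉ VS p2 n2 ∧ v ∉ VS p3 n3} with hUdef
  have hU : ∀ v, v ∈ U ↔ v ∈ S ∧ v ∉ VS p1 n1 ∧ v ∉ VS p2 n2 ∧ v ∉ VS p3 n3 := fun v => Iff.rfl
  have c1 : Cn G (Seg p1 (a + 1) (n1 - b - 1)) := h1.cn (by omega) (by omega)
  have c2 : Cn G (Seg p2 (a + 1) (n2 - b - 1)) := h2.cn (by omega) (by omega)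
  have c3 : Cn G (Seg p3 (a + 1) (n3 - b - 1)) := h3.cn (by omega) (by omega)
  have dU1 : ∀ i j, j ≤ n1 → Disjoint U (Seg p1 i j) := by
    intro i j hj
    rw [Set.disjoint_left]
    rintro v hv ⟨t, t1, t2, rfl⟩
    exact hv.2.1 ⟨t, by omega, rfl⟩
  have dU2 : ∀ i j, j ≤ n2 → Disjoint U (Seg p2 i j) := by
    intro i j hj
    rw [Set.disjoint_left]
    rintro v hv ⟨t, t1, t2, rfl⟩
    exact hv.2.2.1 ⟨t, by omega, rfl⟩
  have dU3 : ∀ i j, j ≤ n3 → Disjoint U (Seg p3 i j) := by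
    intro i j hj
    rw [Set.disjoint_left]
    rintro v hv ⟨t, t1, t2, rfl⟩
    exact hv.2.2.2 ⟨t, by omega, rfl⟩
  obtain ⟨N, hN, hQN, hND, hNcl⟩ := exists_comp G c1
    (Set.subset_union_left (s := Seg p1 (a + 1) (n1 - b - 1)) (t := U))
  have tN2 := caseI_touch hB h3 h1 h2 r13.symm r23.symm r12 (U := U) (fun v => by
    rw [hU]; tauto) hND hN.1 hNcl
  have tN3 := caseI_touch hB h2 h1 h3 r12.symm r23 r13 (U := U) (fun v => by
    rw [hU]; tauto) hND hN.1 hNcl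
  have dAQ1 : Disjoint (Seg p1 0 a) (Seg p1 (a + 1) (n1 - b - 1)) :=
    seg_disj_self h1.inj (by omega) (by omega)
  have dBQ1 : Disjoint (Seg p1 (n1 - b) n1) (Seg p1 (a + 1) (n1 - b - 1)) :=
    (seg_disj_self h1.inj (by omega) (by omega)).symm
  have dAB : Disjoint (Seg p1 0 a) (Seg p1 (n1 - b) n1) :=
    seg_disj_self h1.inj (by omega) (by omega)
  have cA : Cn G (Seg p1 0 a) := h1.cn (by omega) (by omega)
  have cB : Cn G (Seg p1 (n1 - b) n1) := h1.cn (by omega) (by omega)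
  have tAB : Tch G (Seg p1 0 a) (Seg p1 (n1 - b) n1) :=
    ⟨_, mem_seg (t := 0) (by omega) (by omega), _, mem_seg (t := n1) (by omega)
        (by omega), by rw [h1.hn, h1.h0]; exact h1.exy⟩
  have tAQ1 : Tch G (Seg p1 0 a) (Seg p1 (a + 1) (n1 - b - 1)) :=
    ⟨_, mem_seg (t := a) (by omega) (by omega), _, mem_seg (t := a + 1) (by omega)
        (by omega), h1.adj a (by omega)⟩
  have tBQ1 : Tch G (Seg p1 (n1 - b) n1) (Seg p1 (a + 1) (n1 - b - 1)) := by
    refine ⟨_, mem_seg (t := n1 - b) (by omega) (by omega), _, mem_seg (t := n1 - b - 1)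
      (by omega) (by omega), ?_⟩
    have := h1.adj (n1 - b - 1) (by omega)
    rw [show n1 - b - 1 + 1 = n1 - b by omega] at this
    exact this.symm
  have dNA : ∀ i j, j ≤ n1 → Disjoint (Seg p1 i j) (Seg p1 (a + 1) (n1 - b - 1)) →
      Disjoint (Seg p1 i j) N := by
    intro i j hj hd
    rw [Set.disjoint_left]
    intro v hv hv'
    rcases hND hv' with h | h
    · exact Set.disjoint_left.1 hd hv h
    · exact Set.disjoint_left.1 (dU1 i j hj) h hv
  have dN2 : Disjoint N (Seg p2 (a + 1) (n2 - b - 1)) := by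
    rw [Set.disjoint_left]
    intro v hv hv'
    rcases hND hv with h | h
    · exact Set.disjoint_left.1 (r12.dis (by omega)) h hv'
    · exact Set.disjoint_left.1 (dU2 _ _ (by omega)) h hv'
  have dN3 : Disjoint N (Seg p3 (a + 1) (n3 - b - 1)) := by
    rw [Set.disjoint_left]
    intro v hv hv'
    rcases hND hv with h | h
    · exact Set.disjoint_left.1 (r13.dis (by omega)) h hv'
    · exact Set.disjoint_left.1 (dU3 _ _ (by omega)) h hv'
  have k5 : ∀ Z : Set V, Z ⊆ U → Disjoint N Z → Cn G (Seg p2 (a + 1) (n2 - b - 1) ∪ Z) →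
      Tch G (Seg p2 (a + 1) (n2 - b - 1) ∪ Z) (Seg p3 (a + 1) (n3 - b - 1)) → False := by
    intro Z hZU hNZ hYc hYt
    have d1 : ∀ i j, j ≤ n1 → Disjoint (Seg p1 i j) (Seg p2 (a + 1) (n2 - b - 1) ∪ Z) := by
      intro i j hj
      rw [Set.disjoint_union_right]
      exact ⟨r12.dis hj, ((dU1 i j hj).mono_left hZU).symm⟩
    refine no_K5 hB.hyp.pl ![Seg p1 0 a, Seg p1 (n1 - b) n1, N,
      Seg p2 (a + 1) (n2 - b - 1) ∪ Z, Seg p3 (a + 1) (n3 - b - 1)] ?_ ?_ ?_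
    · intro i
      fin_cases i
      · exact cA
      · exact cB
      · exact hN
      · exact hYc
      · exact c3
    · intro i j hij
      fin_cases i <;> fin_cases j <;> first | exact absurd hij (by decide) | skip
      · exact dAB
      · exact dNA _ _ (by omega) dAQ1
      · exact d1 _ _ (by omega)
      · exact r13.dis (by omega)
      · exact dNA _ _ (by omega) dBQ1
      · exact d1 _ _ (by omega)
      · exact r13.dis (by omega)
      · exact Set.disjoint_union_right.2 ⟨dN2, hNZ⟩
      · exact dN3
      · exact Set.disjoint_union_left.2 ⟨r23.dis (by omega), (dU3 _ _ (by omega)).mono_left hZU⟩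
    · intro i j hij
      fin_cases i <;> fin_cases j <;> first | exact absurd hij (by decide) | skip
      · exact tAB
      · exact tAQ1.mono subset_rfl hQN
      · exact (r12.tchA h2).mono subset_rfl Set.subset_union_left
      · exact r13.tchA h3
      · exact tBQ1.mono subset_rfl hQN
      · exact (r12.tchB h2).mono subset_rfl Set.subset_union_left
      · exact r13.tchB h3
      · exact tN2.mono subset_rfl Set.subset_union_left
      · exact tN3
      · exact hYt
  obtain ⟨M, hM, hQM, hMD, hMcl⟩ := exists_comp G c2
    (Set.subset_union_left (s := Seg p2 (a + 1) (n2 - b - 1)) (t := U))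
  obtain ⟨u, huM, v, hv, huv⟩ := caseI_touch hB h1 h2 h3 r12 r13 r23 hU hMD hM.1 hMcl
  rcases hMD huM with hu | hu
  · exact k5 ∅ (Set.empty_subset _) (Set.disjoint_empty _) (by rwa [Set.union_empty])
      ⟨u, Or.inl hu, v, hv, huv⟩
  · obtain ⟨Z, hZ, huZ, hZU, hZcl⟩ := exists_comp G (cn_singleton G u)
      (Set.singleton_subset_iff.2 hu)
    have huZ : u ∈ Z := huZ rfl
    have tZ3 : Tch G Z (Seg p3 (a + 1) (n3 - b - 1)) := ⟨u, huZ, v, hv, huv⟩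
    have tZ2 : Tch G Z (Seg p2 (a + 1) (n2 - b - 1)) := by
      by_contra hcon
      have hEq := hM.2 (M ∩ Z) Set.inter_subset_left ⟨u, huM, huZ⟩ (by
        rintro s ⟨hsM, hsZ⟩ t ht hst
        refine ⟨ht, ?_⟩
        rcases hMD ht with h | h
        · exact absurd ⟨s, hsZ, t, h, hst⟩ hcon
        · exact hZcl s hsZ t h hst)
      obtain ⟨z, hz⟩ := c2.1
      have hzM := hQM hz
      rw [← hEq] at hzM
      exact Set.disjoint_left.1 (dU2 _ _ (by omega)) (hZU hzM.2) hz
    by_cases tZ1 : Tch G Z (Seg p1 (a + 1) (n1 - b - 1))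
    · refine no_K33_lt hB.hyp.pl ![Seg p1 0 a, Seg p1 (n1 - b) n1, Z]
        ![Seg p1 (a + 1) (n1 - b - 1), Seg p2 (a + 1) (n2 - b - 1), Seg p3 (a + 1) (n3 - b - 1)]
        ?_ ?_ ?_ ?_ ?_ ?_
      · intro i
        fin_cases i
        · exact cA
        · exact cB
        · exact hZ
      · intro i
        fin_cases i
        · exact c1
        · exact c2
        · exact c3
      · intro i j hij
        fin_cases i <;> fin_cases j <;> first | exact absurd hij (by decide) | skip
        · exact dAB
        · exact ((dU1 _ _ (by omega)).mono_left hZU).symm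
        · exact ((dU1 _ _ (by omega)).mono_left hZU).symm
      · intro i j hij
        fin_cases i <;> fin_cases j <;> first | exact absurd hij (by decide) | skip
        · exact r12.dis (by omega)
        · exact r13.dis (by omega)
        · exact r23.dis (by omega)
      · intro i j
        fin_cases i <;> fin_cases j
        · exact dAQ1
        · exact r12.dis (by omega)
        · exact r13.dis (by omega)
        · exact dBQ1
        · exact r12.dis (by omega)
        · exact r13.dis (by omega)
        · exact (dU1 _ _ (by omega)).mono_left hZU
        · exact (dU2 _ _ (by omega)).mono_left hZU
        · exact (dU3 _ _ (by omega)).mono_left hZU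
      · intro i j
        fin_cases i <;> fin_cases j
        · exact tAQ1
        · exact r12.tchA h2
        · exact r13.tchA h3
        · exact tBQ1
        · exact r12.tchB h2
        · exact r13.tchB h3
        · exact tZ1
        · exact tZ2
        · exact tZ3
    · have hEq := hN.2 (N \ Z) Set.diff_subset (by
        obtain ⟨z, hz⟩ := c1.1
        exact ⟨z, hQN hz, fun hzZ => Set.disjoint_left.1 (dU1 _ _ (by omega)) (hZU hzZ) hz⟩) (by
        rintro s ⟨hsN, hsZ⟩ t ht hst
        refine ⟨ht, fun htZ => ?_⟩
        rcases hND hsN with h | h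
        · exact tZ1 ⟨t, htZ, s, h, hst.symm⟩
        · exact hsZ (hZcl t htZ s h hst.symm))
      refine k5 Z hZU ?_ (c2.union hZ tZ2.symm) (tZ3.mono Set.subset_union_right subset_rfl)
      rw [Set.disjoint_left]
      intro z hz hzZ
      rw [← hEq] at hz
      exact hz.2 hzZ

theorem L4_lt {G : SimpleGraph V} {S : Finset V} {w : Sym2 V → ℝ} (hB : Bad G S w)
    {x y : V} {p1 p2 p3 : ℕ → V} {n1 n2 n3 a b12 b13 a' b23 : ℕ} (h1 : TP G w x y p1 n1)
    (h2 : TP G w x y p2 n2) (h3 : TP G w x y p3 n3) (r12 : PR p1 n1 p2 n2 a b12)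
    (r13 : PR p1 n1 p3 n3 a b13) (r23 : PR p2 n2 p3 n3 a' b23) (ha : a < a') : False := by
  rcases lt_trichotomy b12 b13 with h | h | h
  · have := r12.rev.ultra r13.rev r23.rev h
    subst this
    exact caseC hB h1 h2 h3 r12 r13 r23 ha h
  · subst h
    exact caseA hB h1 h2 h3 r12 r13 r23 ha
  · have := r13.rev.ultra r12.rev r23.symm.rev h
    subst this
    exact caseC hB h1 h3 h2 r13 r12 r23.symm ha h

theorem L4_all {G : SimpleGraph V} {S : Finset V} {w : Sym2 V → ℝ} (hB : Bad G S w)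
    {x y : V} {p1 p2 p3 : ℕ → V} {n1 n2 n3 a12 a13 a23 b12 b13 b23 : ℕ} (h1 : TP G w x y p1 n1)
    (h2 : TP G w x y p2 n2) (h3 : TP G w x y p3 n3) (r12 : PR p1 n1 p2 n2 a12 b12)
    (r13 : PR p1 n1 p3 n3 a13 b13) (r23 : PR p2 n2 p3 n3 a23 b23)
    (hne : ¬ (a12 = a13 ∧ a12 = a23)) : False := by
  rcases lt_trichotomy a12 a13 with h | h | h
  · have := r12.ultra r13 r23 h
    subst this
    exact L4_lt hB h2 h1 h3 r12.symm r23 r13 h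
  · subst h
    rcases lt_trichotomy a12 a23 with h | h | h
    · exact L4_lt hB h1 h2 h3 r12 r13 r23 h
    · exact hne ⟨rfl, h⟩
    · have := r23.ultra r12.symm r13.symm h
      omega
  · have := r13.ultra r12 r23.symm h
    subst this
    exact L4_lt hB h3 h1 h2 r13.symm r23.symm r12 h

theorem L4 {G : SimpleGraph V} {S : Finset V} {w : Sym2 V → ℝ} (hB : Bad G S w)
    {x y : V} {p1 p2 p3 : ℕ → V} {n1 n2 n3 : ℕ} (h1 : TP G w x y p1 n1)
    (h2 : TP G w x y p2 n2) (h3 : TP G w x y p3 n3)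
    (d12 : ¬ (n1 = n2 ∧ ∀ t ≤ n1, p1 t = p2 t)) (d13 : ¬ (n1 = n3 ∧ ∀ t ≤ n1, p1 t = p3 t))
    (d23 : ¬ (n2 = n3 ∧ ∀ t ≤ n2, p2 t = p3 t)) : False := by
  obtain ⟨a12, b12, r12⟩ := exists_PR hB h1 h2 d12
  obtain ⟨a13, b13, r13⟩ := exists_PR hB h1 h3 d13
  obtain ⟨a23, b23, r23⟩ := exists_PR hB h2 h3 d23
  by_cases ha : a12 = a13 ∧ a12 = a23
  · by_cases hb : b12 = b13 ∧ b12 = b23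
    · obtain ⟨rfl, rfl⟩ := ha
      obtain ⟨rfl, rfl⟩ := hb
      exact caseI hB h1 h2 h3 r12 r13 r23
    · exact L4_all hB h1.rev h2.rev h3.rev r12.rev r13.rev r23.rev hb
  · exact L4_all hB h1 h2 h3 r12 r13 r23 ha

theorem CE_congr {x y : V} {p q : ℕ → V} {n : ℕ} (h : ∀ t ≤ n, p t = q t) :
    CE x y p n = CE x y q n := by
  unfold CE PE
  congr 1
  apply Finset.image_congr
  intro t ht
  simp at ht
  simp only [h t (by omega), h (t + 1) (by omega)]

/-- An edge lies in at most two tight sets. -/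
theorem tight_two {G : SimpleGraph V} {S : Finset V} {w : Sym2 V → ℝ} (hB : Bad G S w)
    {e : Sym2 V} {F1 F2 F3 : Finset (Sym2 V)} (t1 : Tight G w F1) (t2 : Tight G w F2)
    (t3 : Tight G w F3) (m1 : e ∈ F1) (m2 : e ∈ F2) (m3 : e ∈ F3) (d12 : F1 ≠ F2) (d13 : F1 ≠ F3)
    (d23 : F2 ≠ F3) : False := by
  induction e with
  | _ x y =>
  obtain ⟨p1, n1, h1, rfl⟩ := tight_path hB t1 m1
  obtain ⟨p2, n2, h2, rfl⟩ := tight_path hB t2 m2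
  obtain ⟨p3, n3, h3, rfl⟩ := tight_path hB t3 m3
  refine L4 hB h1 h2 h3 ?_ ?_ ?_
  · rintro ⟨rfl, h⟩; exact d12 (CE_congr h)
  · rintro ⟨rfl, h⟩; exact d13 (CE_congr h)
  · rintro ⟨rfl, h⟩; exact d23 (CE_congr h)

theorem tight_card {G : SimpleGraph V} {S : Finset V} {w : Sym2 V → ℝ} (hB : Bad G S w)
    {F : Finset (Sym2 V)} (hF : Tight G w F) : 3 ≤ F.card := by
  by_contra hlt
  have hle : F.card ≤ 2 := by omega
  have hne : F.Nonempty := by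
    obtain ⟨u, v, h, -⟩ := hF.2.1
    exact ⟨_, h⟩
  have h1 : ∑ e ∈ F, w e < ∑ e ∈ F, (1 / 2 : ℝ) :=
    Finset.sum_lt_sum_of_nonempty hne (fun e he => hB.half (hF.1 he))
  rw [Finset.sum_const, nsmul_eq_mul, hF.2.2] at h1
  have : (F.card : ℝ) ≤ 2 := by exact_mod_cast hle
  linarith

end triple2

section improve
open scoped Classical
universe u
set_option linter.unusedSectionVars false
variable {V : Type u} [Fintype V]

/-- The family of tight edge sets. -/
noncomputable def TT (G : SimpleGraph V) (w : Sym2 V → ℝ) : Finset (Finset (Sym2 V)) :=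
  (ES G).powerset.filter (fun F => Tight G w F)

theorem mem_TT {G : SimpleGraph V} {w : Sym2 V → ℝ} {F : Finset (Sym2 V)} :
    F ∈ TT G w ↔ Tight G w F := by
  unfold TT
  rw [Finset.mem_filter, Finset.mem_powerset]
  exact ⟨fun h => h.2, fun h => ⟨h.1, h⟩⟩

theorem TT_lt {G : SimpleGraph V} {S : Finset V} {w : Sym2 V → ℝ} (hB : Bad G S w) :
    (TT G w).card < (ES G).card := by
  have h1 : ∑ F ∈ TT G w, (ES G ∩ F).card ≤ (ES G).card * 2 := by
    apply Finset.sum_card_inter_le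
    intro e _
    by_contra hcon
    push Not at hcon
    rw [Finset.two_lt_card] at hcon
    obtain ⟨F1, h1, F2, h2, F3, h3, d12, d13, d23⟩ := hcon
    rw [Finset.mem_filter, mem_TT] at h1 h2 h3
    exact tight_two hB h1.1 h2.1 h3.1 h1.2 h2.2 h3.2 d12 d13 d23
  have h2 : (TT G w).card * 3 ≤ ∑ F ∈ TT G w, (ES G ∩ F).card := by
    rw [← smul_eq_mul]
    apply Finset.card_nsmul_le_sum
    intro F hF
    rw [mem_TT] at hF
    rw [Finset.inter_eq_right.2 hF.1]
    exact tight_card hB hF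
  have h3 : 0 < (ES G).card := by
    obtain ⟨u, v, h, -⟩ := hB.hyp.cy
    exact Finset.card_pos.2 ⟨_, h⟩
  omega

theorem exists_dir {G : SimpleGraph V} {S : Finset V} {w : Sym2 V → ℝ} (hB : Bad G S w) :
    ∃ d : Sym2 V → ℝ, (∀ F, Tight G w F → ∑ e ∈ F, d e = 0) ∧ ∑ e ∈ ES G, d e ≤ 0 ∧
      ∃ e ∈ ES G, d e < 0 := by
  have key : ∃ d : Sym2 V → ℝ, (∀ F, Tight G w F → ∑ e ∈ F, d e = 0) ∧ ∃ e ∈ ES G, d e ≠ 0 := by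
    let L : (ES G → ℝ) →ₗ[ℝ] (TT G w → ℝ) :=
      LinearMap.pi (fun F => ∑ e : ES G, if e.1 ∈ F.1 then LinearMap.proj e else 0)
    have hker : LinearMap.ker L ≠ ⊥ := by
      apply LinearMap.ker_ne_bot_of_finrank_lt
      simp only [Module.finrank_fintype_fun_eq_card, Fintype.card_coe]
      exact TT_lt hB
    obtain ⟨δ, hδ, hne⟩ := (Submodule.ne_bot_iff _).1 hker
    refine ⟨fun e => if h : e ∈ ES G then δ ⟨e, h⟩ else 0, ?_, ?_⟩
    · intro F hF
      have h1 := congrFun (LinearMap.mem_ker.1 hδ) ⟨F, mem_TT.2 hF⟩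
      simp only [L, LinearMap.pi_apply, LinearMap.sum_apply, Pi.zero_apply] at h1
      refine Eq.trans ?_ h1
      have h2 : ∀ g : Sym2 V → ℝ, ∑ e ∈ F, g e = ∑ e : ES G, if e.1 ∈ F then g e.1 else 0 := by
        intro g
        rw [Finset.sum_coe_sort (ES G) (fun e => if e ∈ F then g e else 0), Finset.sum_ite_mem,
          Finset.inter_eq_right.2 hF.1]
      rw [h2]
      apply Finset.sum_congr rfl
      rintro ⟨e, he⟩ _
      by_cases heF : e ∈ F
      · simp [heF, he]
      · simp [heF]
    · obtain ⟨⟨e, he⟩, hx⟩ := Function.ne_iff.1 hne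
      refine ⟨e, he, ?_⟩
      simpa [he] using hx
  obtain ⟨d, hd, e0, he0, hne⟩ := key
  have fin : ∀ d : Sym2 V → ℝ, (∃ e ∈ ES G, d e ≠ 0) → ∑ e ∈ ES G, d e ≤ 0 →
      ∃ e ∈ ES G, d e < 0 := by
    intro d ⟨e, he, hn⟩ hs
    by_contra hcon
    push Not at hcon
    have h0 := Finset.sum_nonneg hcon
    exact hn ((Finset.sum_eq_zero_iff_of_nonneg hcon).1 (le_antisymm hs h0) e he)
  rcases le_total (∑ e ∈ ES G, d e) 0 with h | h
  · exact ⟨d, hd, h, fin d ⟨e0, he0, hne⟩ h⟩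
  · have h' : ∑ e ∈ ES G, -d e ≤ 0 := by rw [Finset.sum_neg_distrib]; linarith
    refine ⟨fun e => -d e, ?_, h', fin _ ⟨e0, he0, by simpa using hne⟩ h'⟩
    intro F hF
    rw [Finset.sum_neg_distrib, hd F hF, neg_zero]

theorem improve {G : SimpleGraph V} {S : Finset V} {w : Sym2 V → ℝ} (hB : Bad G S w) :
    ∃ w', Bad G S w' ∧ (TT G w).card < (TT G w').card := by
  obtain ⟨d, hd, hs, e0, he0, hneg⟩ := exists_dir hB
  set R1 : Finset ℝ := ((ES G).filter (fun e => d e < 0)).image (fun e => w e / (- d e)) with hR1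
  set R2 : Finset ℝ := ((ES G).powerset.filter (fun F => Cy F ∧ ∑ e ∈ F, d e < 0)).image
    (fun F => (∑ e ∈ F, w e - 1) / (- ∑ e ∈ F, d e)) with hR2
  have hne : (R1 ∪ R2).Nonempty :=
    ⟨w e0 / (- d e0), Finset.mem_union_left _
      (Finset.mem_image.2 ⟨e0, Finset.mem_filter.2 ⟨he0, hneg⟩, rfl⟩)⟩
  obtain ⟨t, ht, hmin⟩ : ∃ t ∈ R1 ∪ R2, ∀ s ∈ R1 ∪ R2, t ≤ s :=
    ⟨_, Finset.min'_mem _ hne, fun s hs => Finset.min'_le _ s hs⟩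
  have ht0 : 0 ≤ t := by
    rcases Finset.mem_union.1 ht with h | h
    · obtain ⟨e, he, rfl⟩ := Finset.mem_image.1 h
      rw [Finset.mem_filter] at he
      exact div_nonneg (hB.hyp.nn e he.1) (by linarith [he.2])
    · obtain ⟨F, hF, rfl⟩ := Finset.mem_image.1 h
      rw [Finset.mem_filter, Finset.mem_powerset] at hF
      have := hB.hyp.cw F hF.1 hF.2.1
      exact div_nonneg (by linarith) (by linarith [hF.2.2])
  have hsum : ∀ F : Finset (Sym2 V), ∑ e ∈ F, (w e + t * d e) = ∑ e ∈ F, w e + t * ∑ e ∈ F, d e := by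
    intro F
    rw [Finset.sum_add_distrib, Finset.mul_sum]
  have hB' : Bad G S (fun e => w e + t * d e) := by
    refine ⟨hB.ih, ⟨hB.hyp.pl, hB.hyp.sup, ?_, ?_, hB.hyp.cy⟩, ?_⟩
    · intro e he
      have h0 := hB.hyp.nn e he
      show 0 ≤ w e + t * d e
      rcases le_or_gt 0 (d e) with h | h
      · have := mul_nonneg ht0 h
        linarith
      · have h1 := hmin _ (Finset.mem_union_left _
          (Finset.mem_image.2 ⟨e, Finset.mem_filter.2 ⟨he, h⟩, rfl⟩))
        rw [le_div_iff₀ (by linarith)] at h1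
        linarith
    · intro F hF hc
      rw [hsum]
      have h0 := hB.hyp.cw F hF hc
      rcases le_or_gt 0 (∑ e ∈ F, d e) with h | h
      · have := mul_nonneg ht0 h
        linarith
      · have h1 := hmin _ (Finset.mem_union_right _
          (Finset.mem_image.2 ⟨F, Finset.mem_filter.2 ⟨Finset.mem_powerset.2 hF, hc, h⟩, rfl⟩))
        rw [le_div_iff₀ (by linarith)] at h1
        linarith
    · intro h
      apply hB.bad
      unfold EulP at h ⊢
      rw [hsum] at h
      have := mul_nonneg ht0 (by linarith : 0 ≤ -∑ e ∈ ES G, d e)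
      linarith
  refine ⟨_, hB', ?_⟩
  apply Finset.card_lt_card
  have hsub : TT G w ⊆ TT G (fun e => w e + t * d e) := by
    intro F hF
    rw [mem_TT] at hF ⊢
    refine ⟨hF.1, hF.2.1, ?_⟩
    rw [hsum, hd F hF, hF.2.2]
    ring
  rw [Finset.ssubset_iff_of_subset hsub]
  rcases Finset.mem_union.1 ht with h | h
  · exfalso
    obtain ⟨e, he, rfl⟩ := Finset.mem_image.1 h
    rw [Finset.mem_filter] at he
    have h1 := hB'.pos he.1
    have h2 : w e / -d e * d e = - w e := by
      have := he.2.ne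
      field_simp
    simp only [h2] at h1
    linarith
  · obtain ⟨F, hF, hFt⟩ := Finset.mem_image.1 h
    rw [Finset.mem_filter, Finset.mem_powerset] at hF
    refine ⟨F, ?_, ?_⟩
    · rw [mem_TT]
      refine ⟨hF.1, hF.2.1, ?_⟩
      rw [hsum, ← hFt]
      have := hF.2.2.ne
      field_simp
      ring
    · rw [mem_TT]
      intro hT
      have := hd F hT
      linarith [hF.2.2]

theorem no_bad {G : SimpleGraph V} {S : Finset V} {w : Sym2 V → ℝ} (hB : Bad G S w) : False := by
  have h : ∀ k : ℕ, ∃ w', Bad G S w' ∧ k ≤ (TT G w').card := by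
    intro k
    induction k with
    | zero => exact ⟨w, hB, Nat.zero_le _⟩
    | succ k ih =>
      obtain ⟨w1, h1, h2⟩ := ih
      obtain ⟨w2, h3, h4⟩ := improve h1
      exact ⟨w2, h3, by omega⟩
  obtain ⟨w', h1, h2⟩ := h (ES G).card
  have := TT_lt h1
  omega

theorem all_ih (m : ℕ) : IHyp V m := by
  induction m with
  | zero => intro G S w h; omega
  | succ m ih =>
    intro G S w h hyp
    by_contra hbad
    refine no_bad (G := G) (S := S) (w := w) ⟨?_, hyp, hbad⟩
    intro G' S' w' h' hyp'
    exact ih G' S' w' (by omega) hyp'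

theorem eul {G : SimpleGraph V} {S : Finset V} {w : Sym2 V → ℝ} (h : Hyp G S w) : EulP G S w :=
  all_ih _ G S w (Nat.lt_succ_self _) h

theorem rc_reach {F : Finset (Sym2 V)} {H : SimpleGraph V} (hF : ∀ a b, s(a, b) ∈ F → H.Adj a b)
    {a b : V} (h : Rc F a b) : H.Reachable a b := by
  induction h with
  | refl => exact Reachable.refl _
  | tail _ h1 ih => exact ih.trans (hF _ _ h1).reachable

theorem cy_card {G : SimpleGraph V} (hg : (7 : ℕ∞) ≤ G.egirth) {F : Finset (Sym2 V)}
    (hF : F ⊆ ES G) (hc : Cy F) : 7 ≤ F.card := by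
  obtain ⟨u, v, huv, hr⟩ := hc
  have hFs : (fromEdgeSet (F : Set (Sym2 V))) ≤ G := by
    intro a b hab
    rw [fromEdgeSet_adj] at hab
    exact mem_ES'.1 (hF (by exact_mod_cast hab.1))
  have hne : ∀ a b, s(a, b) ∈ F → a ≠ b := fun a b h => (mem_ES'.1 (hF h)).ne
  have h1 : (fromEdgeSet (F : Set (Sym2 V))).Adj u v ∧
      ((fromEdgeSet (F : Set (Sym2 V))).deleteEdges {s(u, v)}).Reachable u v := by
    refine ⟨by rw [fromEdgeSet_adj]; exact ⟨by exact_mod_cast huv, hne _ _ huv⟩, ?_⟩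
    refine rc_reach ?_ hr
    intro a b hab
    rw [Finset.mem_erase] at hab
    rw [deleteEdges_adj, fromEdgeSet_adj]
    refine ⟨⟨by exact_mod_cast hab.2, hne _ _ hab.2⟩, ?_⟩
    intro h
    exact hab.1 h
  rw [adj_and_reachable_delete_edges_iff_exists_cycle] at h1
  obtain ⟨x, p, hp, -⟩ := h1
  have h2 : (7 : ℕ∞) ≤ p.length :=
    (hg.trans (egirth_anti hFs)).trans (egirth_le_length hp)
  have h3 : 7 ≤ p.length := by exact_mod_cast h2
  have h4 : p.edges.toFinset.card = p.length := by
    rw [List.toFinset_card_of_nodup hp.isTrail.edges_nodup, Walk.length_edges]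
  have h5 : p.edges.toFinset ⊆ F := by
    intro e he
    rw [List.mem_toFinset] at he
    have := p.edges_subset_edgeSet he
    rw [edgeSet_fromEdgeSet] at this
    exact_mod_cast this.1
  have := Finset.card_le_card h5
  omega

theorem degen {G : SimpleGraph V} (hpl : IsPlanar G) (hg : (7 : ℕ∞) ≤ G.egirth) {S : Finset V}
    (hS : S.Nonempty) : ∃ v ∈ S, (S.filter (fun u => G.Adj v u)).card ≤ 2 := by
  by_contra hcon
  push Not at hcon
  set H := rs G (S : Set V) with hH
  have hdeg : ∀ v ∈ S, 3 ≤ H.degree v := by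
    intro v hv
    have := hcon v hv
    have e : S.filter (fun u => G.Adj v u) = H.neighborFinset v := by
      ext u
      rw [Finset.mem_filter, mem_neighborFinset]
      exact ⟨fun h => ⟨h.2, by exact_mod_cast hv, by exact_mod_cast h.1⟩,
        fun h => ⟨by exact_mod_cast h.2.2, h.1⟩⟩
    rw [← card_neighborFinset_eq_degree, ← e]
    omega
  have hsum := H.sum_degrees_eq_twice_card_edges
  have hES : H.edgeFinset = ES H := by ext e; simp [mem_ES]
  rw [hES] at hsum
  have h1 : S.card * 3 ≤ ∑ v, H.degree v := by
    calc S.card * 3 ≤ ∑ v ∈ S, H.degree v := by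
          rw [← smul_eq_mul]; exact Finset.card_nsmul_le_sum _ _ _ hdeg
      _ ≤ _ := Finset.sum_le_sum_of_subset (Finset.subset_univ _)
  have hsup : ∀ a b, H.Adj a b → a ∈ S ∧ b ∈ S := fun a b h => by
    have := h.2
    exact_mod_cast this
  have hcy : Cy (ES H) := by
    by_contra hc
    have := rs_forest H S hS hsup hc
    omega
  have hsubE : ES H ⊆ ES G := by
    intro e he
    rw [mem_ES] at he ⊢
    exact edgeSet_mono (rs_le G _) he
  have hy : Hyp H S (fun _ => (1 / 7 : ℝ)) := by
    refine ⟨planar_mono (rs_le G _) hpl, hsup, fun _ _ => by norm_num, ?_, hcy⟩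
    intro F hF hc
    have := cy_card hg (hF.trans hsubE) hc
    rw [Finset.sum_const, nsmul_eq_mul]
    have h' : (7 : ℝ) ≤ F.card := by exact_mod_cast this
    linarith
  have := eul hy
  unfold EulP at this
  rw [Finset.sum_const, nsmul_eq_mul] at this
  have h2 : (S.card : ℝ) * 3 ≤ 2 * (ES H).card := by exact_mod_cast (by omega : S.card * 3 ≤ 2 * (ES H).card)
  have h3 : (0 : ℝ) ≤ (ES H).card := by positivity
  linarith

end improve

section coloring
open scoped Classical
universe u
set_option linter.unusedSectionVars false
variable {V : Type u} [Fintype V]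

theorem ur_step {H H' : SimpleGraph V} {v : V} {c : Sym2 V → ℕ} {γ : V → ℕ} {c' : Sym2 V → ℕ}
    (hE : ∀ e, e ∈ H'.edgeSet ↔ e ∈ H.edgeSet ∧ v ∉ e)
    (hinj : ∀ x y, H.Adj v x → H.Adj v y → γ x = γ y → x = y)
    (hav : ∀ x y, H.Adj v x → H.Adj v y → ∀ f ∈ H'.edgeSet, y ∈ f → c f ≠ γ x)
    (hc1 : ∀ x, c' s(v, x) = γ x) (hc2 : ∀ e, v ∉ e → c' e = c e) (i : ℕ)
    (hU : IsUniquelyRestrictedMatching H' {e | e ∈ H'.edgeSet ∧ c e = i}) :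
    IsUniquelyRestrictedMatching H {e | e ∈ H.edgeSet ∧ c' e = i} := by
  obtain ⟨hM, huniq⟩ := hU
  have hv : ∀ e ∈ H.edgeSet, v ∈ e → ∃ x, H.Adj v x ∧ e = s(v, x) := by
    intro e he hve
    obtain ⟨x, rfl⟩ := hve
    exact ⟨x, he, rfl⟩
  have hm : IsMatchingSet H {e | e ∈ H.edgeSet ∧ c' e = i} := by
    refine ⟨fun e he => he.1, ?_⟩
    have mixed : ∀ e ∈ {e | e ∈ H.edgeSet ∧ c' e = i}, ∀ f ∈ {e | e ∈ H.edgeSet ∧ c' e = i},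
        v ∈ e → v ∉ f → ∀ x, x ∈ e → x ∉ f := by
      rintro e ⟨he, hei⟩ f ⟨hf, hfi⟩ hve hvf x hxe hxf
      obtain ⟨a, ha, rfl⟩ := hv e he hve
      rw [Sym2.mem_iff] at hxe
      rcases hxe with rfl | rfl
      · exact hvf hxf
      · rw [hc1] at hei
        rw [hc2 f hvf] at hfi
        exact hav x x ha ha f ((hE f).2 ⟨hf, hvf⟩) hxf (hfi.trans hei.symm)
    intro e he f hf hne x hxe hxf
    by_cases hve : v ∈ e
    · by_cases hvf : v ∈ f
      · obtain ⟨a, ha, rfl⟩ := hv e he.1 hve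
        obtain ⟨b, hb, rfl⟩ := hv f hf.1 hvf
        have h1 := he.2
        have h2 := hf.2
        rw [hc1] at h1 h2
        exact hne (by rw [hinj a b ha hb (h1.trans h2.symm)])
      · exact mixed e he f hf hve hvf x hxe hxf
    · by_cases hvf : v ∈ f
      · exact mixed f hf e he hvf hve x hxf hxe
      · refine hM.2 e ⟨(hE e).2 ⟨he.1, hve⟩, ?_⟩ f ⟨(hE f).2 ⟨hf.1, hvf⟩, ?_⟩ hne x hxe hxf
        · rw [← hc2 e hve]; exact he.2
        · rw [← hc2 f hvf]; exact hf.2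
  refine ⟨hm, ?_⟩
  intro N hN
  obtain ⟨hNm, hNs, hNc⟩ := hN
  by_cases hvc : v ∈ cov {e | e ∈ H.edgeSet ∧ c' e = i}
  · obtain ⟨e, he, hve⟩ := hvc
    obtain ⟨a, ha, rfl⟩ := hv e he.1 hve
    have hai : γ a = i := by rw [← hc1]; exact he.2
    have hMeq : {e | e ∈ H.edgeSet ∧ c' e = i} =
        insert s(v, a) {e | e ∈ H'.edgeSet ∧ c e = i} := by
      ext g
      simp only [Set.mem_insert_iff, Set.mem_ofPred_eq]
      constructor
      · rintro ⟨h1, h2⟩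
        by_cases hvg : v ∈ g
        · obtain ⟨b, hb, rfl⟩ := hv g h1 hvg
          left
          rw [hc1] at h2
          rw [hinj b a hb ha (h2.trans hai.symm)]
        · right
          exact ⟨(hE g).2 ⟨h1, hvg⟩, by rw [← hc2 g hvg]; exact h2⟩
      · rintro (rfl | ⟨h1, h2⟩)
        · exact he
        · have h3 := (hE g).1 h1
          exact ⟨h3.1, by rw [hc2 g h3.2]; exact h2⟩
    have hnob : ∀ b, H.Adj v b → ∀ g ∈ {e | e ∈ H'.edgeSet ∧ c e = i}, b ∉ g := by
      intro b hb g hg hbg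
      exact hav a b ha hb g hg.1 hbg (hg.2.trans hai.symm)
    have hin : s(v, a) ∈ N := by
      have : v ∈ cov N := by rw [hNc]; exact ⟨_, he, hve⟩
      obtain ⟨f, hf, hvf⟩ := this
      obtain ⟨b, hb, rfl⟩ := hv f (hNm.1 hf) hvf
      obtain ⟨g, hg, hbg⟩ := hNs _ hf b (Sym2.mem_mk_right _ _)
      rw [hMeq] at hg
      rcases hg with rfl | hg
      · rw [Sym2.mem_iff] at hbg
        rcases hbg with h | rfl
        · exact absurd h hb.ne'
        · exact hf
      · exact absurd hbg (hnob b hb g hg)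
    have hdis : ∀ f ∈ N, f ≠ s(v, a) → v ∉ f ∧ a ∉ f := by
      intro f hf hne
      exact ⟨hNm.2 _ hin f hf hne.symm v (Sym2.mem_mk_left _ _),
        hNm.2 _ hin f hf hne.symm a (Sym2.mem_mk_right _ _)⟩
    have hN' : N \ {s(v, a)} = {e | e ∈ H'.edgeSet ∧ c e = i} := by
      apply huniq
      have hcv : ∀ f ∈ N \ {s(v, a)}, ∀ x, x ∈ f → x ∈ cov {e | e ∈ H'.edgeSet ∧ c e = i} := by
        intro f hf x hx
        obtain ⟨g, hg, hxg⟩ := hNs f hf.1 x hx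
        rw [hMeq] at hg
        have hd := hdis f hf.1 hf.2
        rcases hg with rfl | hg
        · rw [Sym2.mem_iff] at hxg
          rcases hxg with rfl | rfl
          · exact absurd hx hd.1
          · exact absurd hx hd.2
        · exact ⟨g, hg, hxg⟩
      refine ⟨⟨?_, ?_⟩, hcv, ?_⟩
      · intro f hf
        exact (hE f).2 ⟨hNm.1 hf.1, (hdis f hf.1 hf.2).1⟩
      · intro e he f hf
        exact hNm.2 e he.1 f hf.1
      · apply Set.Subset.antisymm
        · rintro x ⟨f, hf, hx⟩
          exact hcv f hf x hx
        · rintro x ⟨g, hg, hx⟩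
          have : x ∈ cov N := by
            rw [hNc, hMeq]
            exact ⟨g, Or.inr hg, hx⟩
          obtain ⟨f, hf, hxf⟩ := this
          refine ⟨f, ⟨hf, ?_⟩, hxf⟩
          intro hfe
          rw [Set.mem_singleton_iff] at hfe
          subst hfe
          rw [Sym2.mem_iff] at hxf
          rcases hxf with rfl | rfl
          · exact ((hE g).1 hg.1).2 hx
          · exact hnob x ha g hg hx
    rw [hMeq, ← hN', Set.insert_sdiff_singleton, Set.insert_eq_of_mem hin]
  · have hnv : ∀ e ∈ {e | e ∈ H.edgeSet ∧ c' e = i}, v ∉ e := fun e he h => hvc ⟨e, he, h⟩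
    have hMeq : {e | e ∈ H.edgeSet ∧ c' e = i} = {e | e ∈ H'.edgeSet ∧ c e = i} := by
      ext g
      constructor
      · intro hg
        have h := hnv g hg
        exact ⟨(hE g).2 ⟨hg.1, h⟩, by rw [← hc2 g h]; exact hg.2⟩
      · rintro ⟨h1, h2⟩
        have h3 := (hE g).1 h1
        exact ⟨h3.1, by rw [hc2 g h3.2]; exact h2⟩
    rw [hMeq] at hNs hNc hvc ⊢
    apply huniq
    refine ⟨⟨?_, hNm.2⟩, hNs, hNc⟩
    intro f hf
    exact (hE f).2 ⟨hNm.1 hf, fun h => hvc (hNs f hf v h)⟩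

theorem natDeg_eq (G : SimpleGraph V) (v : V) :
    natDeg G v = (Finset.univ.filter (fun u => G.Adj v u)).card := by
  unfold natDeg
  rw [← Set.ncard_coe_finset]
  congr 1
  ext u
  simp

theorem col_step {G H H' : SimpleGraph V} {v : V} {c : Sym2 V → ℕ} {Δ : ℕ}
    (hE : ∀ e, e ∈ H'.edgeSet ↔ e ∈ H.edgeSet ∧ v ∉ e) (hHG : H ≤ G)
    (hub : ∀ v, natDeg G v ≤ Δ) (h2 : (Finset.univ.filter (fun u => H.Adj v u)).card ≤ 2)
    (hc : IsPColoring H' IsUniquelyRestrictedMatching c (2 * Δ)) :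
    ∃ c', IsPColoring H IsUniquelyRestrictedMatching c' (2 * Δ) := by
  set N := Finset.univ.filter (fun u => H.Adj v u) with hN
  have memN : ∀ x, x ∈ N ↔ H.Adj v x := by intro x; simp [N]
  set A : Finset ℕ := N.biUnion
    (fun y => (Finset.univ.filter (fun z => H'.Adj y z)).image (fun z => c s(y, z))) with hA
  have hAcard : A.card ≤ N.card * (Δ - 1) := by
    apply Finset.card_biUnion_le_card_mul
    intro y hy
    refine Finset.card_image_le.trans ?_
    have h3 : insert v (Finset.univ.filter (fun z => H'.Adj y z)) ⊆
        Finset.univ.filter (fun z => G.Adj y z) := by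
      intro z hz
      rw [Finset.mem_insert, Finset.mem_filter] at hz
      rw [Finset.mem_filter]
      refine ⟨Finset.mem_univ _, ?_⟩
      rcases hz with rfl | hz
      · exact hHG ((memN y).1 hy).symm
      · exact hHG ((hE s(y, z)).1 hz.2).1
    have h4 := Finset.card_le_card h3
    rw [Finset.card_insert_of_notMem, ← natDeg_eq G] at h4
    · have := hub y
      omega
    · intro h
      rw [Finset.mem_filter] at h
      exact ((hE s(y, v)).1 h.2).2 (Sym2.mem_mk_right _ _)
  have hΔ : N.card ≤ Δ := by
    refine le_trans ?_ (hub v)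
    rw [natDeg_eq]
    apply Finset.card_le_card
    intro x hx
    rw [memN] at hx
    exact Finset.mem_filter.2 ⟨Finset.mem_univ _, hHG hx⟩
  have hle : N.card ≤ (Finset.range (2 * Δ) \ A).card := by
    have h5 := Finset.le_card_sdiff A (Finset.range (2 * Δ))
    rw [Finset.card_range] at h5
    generalize N.card = n at *
    interval_cases n <;> omega
  obtain ⟨f⟩ : Nonempty (N ↪ (Finset.range (2 * Δ) \ A : Finset ℕ)) := by
    apply Function.Embedding.nonempty_of_card_le
    simpa only [Fintype.card_coe] using hle
  set γ : V → ℕ := fun x => if h : x ∈ N then (f ⟨x, h⟩).1 else 0 with hγ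
  have hγN : ∀ x (h : x ∈ N), γ x = (f ⟨x, h⟩).1 := by
    intro x h
    simp only [hγ, dif_pos h]
  have hγm : ∀ x, x ∈ N → γ x < 2 * Δ ∧ γ x ∉ A := by
    intro x h
    rw [hγN x h]
    have := (f ⟨x, h⟩).2
    rw [Finset.mem_sdiff, Finset.mem_range] at this
    exact this
  set c' : Sym2 V → ℕ := fun e => if h : v ∈ e then γ (Sym2.Mem.other h) else c e with hc'
  have hc1 : ∀ x, c' s(v, x) = γ x := by
    intro x
    have h : v ∈ s(v, x) := Sym2.mem_mk_left _ _
    simp only [hc', dif_pos h]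
    have := Sym2.other_spec h
    rw [Sym2.congr_right] at this
    rw [this]
  have hc2 : ∀ e, v ∉ e → c' e = c e := by
    intro e h
    simp only [hc', dif_neg h]
  refine ⟨c', ?_, ?_⟩
  · intro e he
    by_cases hve : v ∈ e
    · obtain ⟨x, rfl⟩ := hve
      rw [hc1]
      exact (hγm x ((memN x).2 he)).1
    · rw [hc2 e hve]
      exact hc.1 e ((hE e).2 ⟨he, hve⟩)
  · intro i
    refine ur_step (γ := γ) hE ?_ ?_ hc1 hc2 i (hc.2 i)
    · intro x y hx hy hxy
      rw [← memN] at hx hy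
      rw [hγN x hx, hγN y hy] at hxy
      have := f.injective (Subtype.ext hxy)
      exact congrArg Subtype.val this
    · intro x y hx hy g hg hyg heq
      apply (hγm x ((memN x).2 hx)).2
      rw [← heq]
      obtain ⟨z, rfl⟩ := hyg
      refine Finset.mem_biUnion.2 ⟨y, (memN y).2 hy, Finset.mem_image.2 ⟨z, ?_, rfl⟩⟩
      exact Finset.mem_filter.2 ⟨Finset.mem_univ _, hg⟩

theorem col_all {G : SimpleGraph V} {Δ : ℕ} (hpl : IsPlanar G) (hg : (7 : ℕ∞) ≤ G.egirth)
    (hub : ∀ v, natDeg G v ≤ Δ) (n : ℕ) : ∀ S : Finset V, S.card = n →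
    ∃ c, IsPColoring (rs G (S : Set V)) IsUniquelyRestrictedMatching c (2 * Δ) := by
  induction n with
  | zero =>
    intro S hS
    rw [Finset.card_eq_zero] at hS
    subst hS
    have hno : ∀ e, e ∉ (rs G ((∅ : Finset V) : Set V)).edgeSet := by
      intro e
      induction e with
      | _ x y =>
      intro h
      have := h.2.1
      simp at this
    refine ⟨fun _ => 0, fun e he => absurd he (hno e), fun i => ⟨⟨fun e he => he.1, ?_⟩, ?_⟩⟩
    · intro e he
      exact absurd he.1 (hno e)
    · intro M hM
      ext e
      exact ⟨fun h => absurd (hM.1.1 h) (hno e), fun h => absurd h.1 (hno e)⟩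
  | succ n ih =>
    intro S hS
    obtain ⟨v, hv, hd⟩ := degen hpl hg (S := S) (Finset.card_pos.1 (by omega))
    obtain ⟨c, hc⟩ := ih (S.erase v) (by rw [Finset.card_erase_of_mem hv]; omega)
    refine col_step (v := v) ?_ (rs_le G _) hub ?_ hc
    · intro e
      induction e with
      | _ x y =>
      simp only [mem_edgeSet, rs, Sym2.mem_iff, Finset.coe_erase, Set.mem_sdiff,
        Set.mem_singleton_iff, Finset.mem_coe]
      constructor
      · rintro ⟨h1, ⟨h2, h3⟩, h4, h5⟩
        exact ⟨⟨h1, h2, h4⟩, fun h => h.elim (fun h => h3 h.symm) (fun h => h5 h.symm)⟩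
      · rintro ⟨⟨h1, h2, h4⟩, h⟩
        exact ⟨h1, ⟨h2, fun h' => h (Or.inl h'.symm)⟩, h4, fun h' => h (Or.inr h'.symm)⟩
    · refine le_trans (Finset.card_le_card ?_) hd
      intro u hu
      rw [Finset.mem_filter] at hu ⊢
      exact ⟨by exact_mod_cast hu.2.2.2, hu.2.1⟩

theorem ur_bound {G : SimpleGraph V} {Δ : ℕ} (hpl : IsPlanar G) (hg : (7 : ℕ∞) ≤ G.egirth)
    (hub : ∀ v, natDeg G v ≤ Δ) : urIndex G ≤ 2 * Δ := by
  obtain ⟨c, hc⟩ := col_all hpl hg hub _ Finset.univ rfl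
  have : rs G ((Finset.univ : Finset V) : Set V) = G := by
    ext a b
    simp [rs]
  rw [this] at hc
  exact Nat.sInf_le ⟨c, hc⟩

end coloring

/-- A planar graph with maximum degree `Δ` and girth at least 8 satisfies
`χ'_ur(G) ≤ 2Δ+2`, and with girth at least 7 satisfies `χ'_ur(G) ≤ 2Δ+4`. -/
theorem urIndex_planar_girth {V : Type*} [Fintype V] (G : SimpleGraph V)
    (Δ : ℕ) (hplanar : IsPlanar G)
    (hub : ∀ v, natDeg G v ≤ Δ) (hex : ∃ v, natDeg G v = Δ) :
    ((8 : ℕ∞) ≤ G.egirth → urIndex G ≤ 2 * Δ + 2) ∧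
    ((7 : ℕ∞) ≤ G.egirth → urIndex G ≤ 2 * Δ + 4) := by
  refine ⟨fun h => ?_, fun h => ?_⟩
  · have h7 : (7 : ℕ∞) ≤ 8 := by exact_mod_cast (by norm_num : (7 : ℕ) ≤ 8)
    have := ur_bound hplanar (h7.trans h) hub
    omega
  · have := ur_bound hplanar h hub
    omega

end SSE
end

section
/- If G is a connected graph of maximum degree at most 2 other than C_4 and C_7, then χ'_ss(G) ≤ 3; moreover χ'_ss(C_4) = χ'_ss(C_7) = 4. -/
namespace SSE

open SimpleGraph

variable {V : Type*} {W : Type*}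

theorem pullback {A B : Type} (G : SimpleGraph A) (H : SimpleGraph B) (φ : A → B)
    (hφ : Function.Injective φ) (hom : ∀ x y, G.Adj x y → H.Adj (φ x) (φ y)) (k : ℕ)
    (h : ∃ c, IsPColoring H IsSemistrongMatching c k) :
    ∃ c, IsPColoring G IsSemistrongMatching c k := by
  obtain ⟨c, hc1, hc2⟩ := h
  have hedge : ∀ e ∈ G.edgeSet, e.map φ ∈ H.edgeSet := by
    intro e
    induction e with | _ x y => exact hom x y
  refine ⟨fun e => c (e.map φ), fun e he => hc1 _ (hedge e he), fun i => ?_⟩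
  obtain ⟨⟨_, hm⟩, hp⟩ := hc2 i
  have hcov : ∀ v, v ∈ cov {e | e ∈ G.edgeSet ∧ c (e.map φ) = i} →
      φ v ∈ cov {e | e ∈ H.edgeSet ∧ c e = i} := by
    rintro v ⟨e, ⟨he, hce⟩, hv⟩
    exact ⟨e.map φ, ⟨hedge e he, hce⟩, Sym2.mem_map.2 ⟨v, hv, rfl⟩⟩
  refine ⟨⟨fun e he => he.1, ?_⟩, ?_⟩
  · rintro e ⟨he, hce⟩ f ⟨hf, hcf⟩ hef v hve hvf
    exact hm (e.map φ) ⟨hedge e he, hce⟩ (f.map φ) ⟨hedge f hf, hcf⟩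
      (fun h => hef (Sym2.map.injective hφ h)) (φ v) (Sym2.mem_map.2 ⟨v, hve, rfl⟩)
      (Sym2.mem_map.2 ⟨v, hvf, rfl⟩)
  · rintro e ⟨he, hce⟩
    obtain ⟨v', hv', _, hu⟩ := hp (e.map φ) ⟨hedge e he, hce⟩
    obtain ⟨v, hv, rfl⟩ := Sym2.mem_map.1 hv'
    obtain ⟨u, rfl⟩ := Sym2.mem_iff_exists.1 hv
    have hucov : u ∈ cov {e | e ∈ G.edgeSet ∧ c (e.map φ) = i} :=
      ⟨s(v, u), ⟨he, hce⟩, Sym2.mem_mk_right v u⟩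
    refine ⟨v, hv, ⟨s(v, u), ⟨he, hce⟩, hv⟩, u, ⟨hucov, he⟩, ?_⟩
    rintro y ⟨hy, hvy⟩
    exact hφ (hu.unique ⟨hcov y hy, hom _ _ hvy⟩ ⟨hcov u hucov, hom _ _ he⟩)

theorem cyc_adj (m : ℕ) (u v : Fin (m + 3)) :
    (SimpleGraph.cycleGraph (m + 3)).Adj u v ↔ v = u + 1 ∨ u = v + 1 := by
  rw [SimpleGraph.cycleGraph_adj]
  constructor
  · rintro (h | h)
    · right; rw [← h]; abel
    · left; rw [← h]; abel
  · rintro (h | h)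
    · right; rw [h]; abel
    · left; rw [h]; abel

theorem two_ne (m : ℕ) (u : Fin (m + 3)) : u + 1 + 1 ≠ u := by
  intro h
  have h2 : (1 : Fin (m + 3)) + 1 = 0 := by
    have : u + (1 + 1) = u + 0 := by rw [← add_assoc, h, add_zero]
    exact add_left_cancel this
  have := congrArg Fin.val h2
  rw [Fin.val_add] at this
  simp [Nat.mod_eq_of_lt] at this

theorem one_ne (m : ℕ) (u : Fin (m + 3)) : u + 1 ≠ u := by
  intro h
  have h1 : (1 : Fin (m + 3)) = 0 := by
    have : u + 1 = u + 0 := by rw [h, add_zero]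
    exact add_left_cancel this
  simp at h1

theorem edge_inj_s18 (m : ℕ) (i j : Fin (m + 3)) (h : s(i, i + 1) = s(j, j + 1)) : i = j := by
  rw [Sym2.eq_iff] at h
  rcases h with h | ⟨h1, h2⟩
  · exact h.1
  · rw [h1] at h2
    exact absurd h2 (two_ne m j)

theorem edge_form (m : ℕ) (e : Sym2 (Fin (m + 3))) :
    e ∈ (SimpleGraph.cycleGraph (m + 3)).edgeSet ↔ ∃ i, e = s(i, i + 1) := by
  induction e with
  | _ x y =>
    rw [SimpleGraph.mem_edgeSet, cyc_adj]
    constructor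
    · rintro (h | h)
      · exact ⟨x, by rw [h]⟩
      · exact ⟨y, by rw [h, Sym2.eq_swap]⟩
    · rintro ⟨i, h⟩
      rw [Sym2.eq_iff] at h
      rcases h with ⟨h1, h2⟩ | ⟨h1, h2⟩
      · left; rw [h1, h2]
      · right; rw [h1, h2]

/-- The word condition on a cycle. -/
def GoodWord (m : ℕ) (w : Fin (m + 3) → ℕ) (k : ℕ) : Prop :=
  (∀ i, w i < k) ∧ (∀ i, w i ≠ w (i + 1)) ∧
    ∀ i, ¬ (w i = w (i + 1 + 1) ∧ w (i + 1 + 1) = w (i + 1 + 1 + 1 + 1))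

theorem coloring_of_word (m k : ℕ) (w : Fin (m + 3) → ℕ) (hw : GoodWord m w k) :
    ∃ c, IsPColoring (SimpleGraph.cycleGraph (m + 3)) IsSemistrongMatching c k := by
  classical
  obtain ⟨hlt, hne, htr⟩ := hw
  let c : Sym2 (Fin (m + 3)) → ℕ := fun e => if h : ∃ i, e = s(i, i + 1) then w h.choose else 0
  have hc : ∀ i, c s(i, i + 1) = w i := by
    intro i
    have h : ∃ j, s(i, i + 1) = s(j, j + 1) := ⟨i, rfl⟩
    have : c s(i, i + 1) = w h.choose := dif_pos h
    rw [this, ← edge_inj_s18 m _ _ h.choose_spec]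
  have hcov : ∀ k v, v + 1 ∈ cov {e | e ∈ (SimpleGraph.cycleGraph (m + 3)).edgeSet ∧ c e = k} →
      w v = k ∨ w (v + 1) = k := by
    rintro k v ⟨e, ⟨he, hce⟩, hv⟩
    obtain ⟨i, rfl⟩ := (edge_form m e).1 he
    rw [hc] at hce
    rcases Sym2.mem_iff.1 hv with h | h
    · right; rw [h]; exact hce
    · left; rw [add_right_cancel h]; exact hce
  have hmem : ∀ i, s(i, i + 1) ∈ (SimpleGraph.cycleGraph (m + 3)).edgeSet :=
    fun i => (edge_form m _).2 ⟨i, rfl⟩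
  refine ⟨c, ?_, fun k => ⟨⟨fun e he => he.1, ?_⟩, ?_⟩⟩
  · intro e he
    obtain ⟨i, rfl⟩ := (edge_form m e).1 he
    rw [hc]; exact hlt i
  · rintro e ⟨he, hce⟩ f ⟨hf, hcf⟩ hef v hve hvf
    obtain ⟨i, rfl⟩ := (edge_form m e).1 he
    obtain ⟨j, rfl⟩ := (edge_form m f).1 hf
    rw [hc] at hce hcf
    rcases Sym2.mem_iff.1 hve with h | h <;> rcases Sym2.mem_iff.1 hvf with h' | h'
    · exact hef (by rw [← h, ← h'])
    · apply hne j; rw [← h', h, hce, hcf]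
    · apply hne i; rw [← h, h', hce, hcf]
    · have := add_right_cancel (h.symm.trans h'); exact hef (by rw [this])
  · rintro e ⟨he, hce⟩
    obtain ⟨j', rfl⟩ := (edge_form m e).1 he
    obtain ⟨j, rfl⟩ : ∃ j, j' = j + 1 + 1 := ⟨j' - 1 - 1, by abel⟩
    have hce' := hce
    rw [hc] at hce'
    have hl : j + 1 + 1 ∈ cov {e | e ∈ (SimpleGraph.cycleGraph (m + 3)).edgeSet ∧ c e = k} :=
      ⟨_, ⟨he, hce⟩, Sym2.mem_mk_left _ _⟩
    have hr : j + 1 + 1 + 1 ∈ cov {e | e ∈ (SimpleGraph.cycleGraph (m + 3)).edgeSet ∧ c e = k} :=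
      ⟨_, ⟨he, hce⟩, Sym2.mem_mk_right _ _⟩
    by_cases hj : w j = k
    · have h4 : w (j + 1 + 1 + 1 + 1) ≠ k := fun h => htr j ⟨by rw [hj, hce'], by rw [hce', h]⟩
      refine ⟨j + 1 + 1 + 1, Sym2.mem_mk_right _ _, hr, j + 1 + 1,
        ⟨hl, (cyc_adj m _ _).2 (Or.inr rfl)⟩, ?_⟩
      rintro y ⟨hy, hay⟩
      rcases (cyc_adj m _ _).1 hay with h | h
      · rw [h] at hy
        rcases hcov k _ hy with h | h
        · exact absurd (hce'.trans h.symm) (hne _)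
        · exact absurd h h4
      · exact (add_right_cancel h).symm
    · refine ⟨j + 1 + 1, Sym2.mem_mk_left _ _, hl, j + 1 + 1 + 1,
        ⟨hr, (cyc_adj m _ _).2 (Or.inl rfl)⟩, ?_⟩
      rintro y ⟨hy, hay⟩
      rcases (cyc_adj m _ _).1 hay with h | h
      · exact h
      · have h := (add_right_cancel h).symm
        rw [h] at hy
        rcases hcov k _ hy with h | h
        · exact absurd h hj
        · exact absurd (h.trans hce'.symm) (hne _)

theorem word_of_coloring (m k : ℕ)
    (h : ∃ c, IsPColoring (SimpleGraph.cycleGraph (m + 3)) IsSemistrongMatching c k) :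
    ∃ w, GoodWord m w k := by
  obtain ⟨c, hc1, hc2⟩ := h
  have hmem : ∀ i, s(i, i + 1) ∈ (SimpleGraph.cycleGraph (m + 3)).edgeSet :=
    fun i => (edge_form m _).2 ⟨i, rfl⟩
  refine ⟨fun i => c s(i, i + 1), fun i => hc1 _ (hmem i), ?_, ?_⟩
  · intro i h
    refine (hc2 (c s(i, i + 1))).1.2 s(i, i + 1) ⟨hmem i, rfl⟩ s(i + 1, i + 1 + 1)
      ⟨hmem _, h.symm⟩ ?_ (i + 1) (Sym2.mem_mk_right _ _) (Sym2.mem_mk_left _ _)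
    intro h'
    exact one_ne m i (edge_inj_s18 m _ _ h').symm
  · rintro i ⟨h1, h2⟩
    dsimp only at h1 h2
    set k := c s(i + 1 + 1, i + 1 + 1 + 1) with hk
    obtain ⟨v, hv, _, hu⟩ := (hc2 k).2 s(i + 1 + 1, i + 1 + 1 + 1) ⟨hmem _, hk.symm⟩
    have hA : ∀ j, c s(j, j + 1) = k →
      j ∈ cov {e | e ∈ (SimpleGraph.cycleGraph (m + 3)).edgeSet ∧ c e = k} :=
      fun j hj => ⟨_, ⟨hmem j, hj⟩, Sym2.mem_mk_left _ _⟩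
    have hB : ∀ j, c s(j, j + 1) = k →
      j + 1 ∈ cov {e | e ∈ (SimpleGraph.cycleGraph (m + 3)).edgeSet ∧ c e = k} :=
      fun j hj => ⟨_, ⟨hmem j, hj⟩, Sym2.mem_mk_right _ _⟩
    rcases Sym2.mem_iff.1 hv with h | h <;> subst h
    · exact two_ne m (i + 1) (hu.unique ⟨hB _ hk.symm, (cyc_adj m _ _).2 (Or.inl rfl)⟩
        ⟨hB i h1, (cyc_adj m _ _).2 (Or.inr rfl)⟩)
    · exact two_ne m (i + 1 + 1) (hu.unique ⟨hA _ h2.symm, (cyc_adj m _ _).2 (Or.inl rfl)⟩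
        ⟨hA _ hk.symm, (cyc_adj m _ _).2 (Or.inr rfl)⟩)

/-- A word made of `b` blocks `01012` followed by blocks `012`. -/
def wd (b i : ℕ) : ℕ := if i < 5 * b then (if i % 5 < 4 then i % 5 % 2 else 2) else (i - 5 * b) % 3

set_option maxHeartbeats 2000000 in
theorem wd_good (m b : ℕ) (hb : b ≤ 2) (hm : 5 * b ≤ m + 3) (h3 : (m + 3 - 5 * b) % 3 = 0) :
    GoodWord m (fun i => wd b i.val) 3 := by
  have hs : ∀ i : Fin (m + 3), (i + 1).val = i.val + 1 ∧ i.val + 1 < m + 3 ∨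
      (i + 1).val = 0 ∧ i.val + 1 = m + 3 := by
    intro i
    have hi := i.2
    rw [Fin.val_add_one]
    split_ifs with h
    · right; refine ⟨rfl, ?_⟩; rw [h]; simp
    · left; refine ⟨rfl, ?_⟩
      have : i.val ≠ m + 2 := fun h' => h (Fin.ext (by simpa using h'))
      omega
  have key1 : ∀ i, wd b i < 3 := by
    intro i; unfold wd; split_ifs <;> omega
  refine ⟨fun i => key1 _, fun i => ?_, fun i => ?_⟩
  · have h1 := hs i
    dsimp only
    generalize (i + 1).val = j1 at *
    generalize i.val = j0 at *
    unfold wd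
    rcases h1 with h1 | h1 <;> interval_cases b <;> split_ifs <;> omega
  · have h1 := hs i
    have h2 := hs (i + 1)
    have h3' := hs (i + 1 + 1)
    have h4 := hs (i + 1 + 1 + 1)
    dsimp only
    generalize (i + 1 + 1 + 1 + 1).val = j4 at *
    generalize (i + 1 + 1 + 1).val = j3 at *
    generalize (i + 1 + 1).val = j2 at *
    generalize (i + 1).val = j1 at *
    generalize i.val = j0 at *
    have h24 : j2 = j0 + 2 ∧ j4 = j0 + 4 ∧ j0 + 4 < m + 3 ∨
      j2 = j0 + 2 ∧ j4 + (m + 3) = j0 + 4 ∨ j2 + (m + 3) = j0 + 2 ∧ j4 = j2 + 2 ∨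
      m = 0 ∧ j0 = 2 ∧ j2 = 1 ∧ j4 = 0 := by omega
    have hj0 : j0 < m + 3 ∧ j2 < m + 3 := by omega
    clear h1 h2 h3' h4 hs key1
    unfold wd
    rcases h24 with h24 | h24 | h24 | h24 <;> interval_cases b <;> split_ifs <;> omega

theorem cyc_three (m : ℕ) (h4 : m ≠ 1) (h7 : m ≠ 4) :
    ∃ c, IsPColoring (SimpleGraph.cycleGraph (m + 3)) IsSemistrongMatching c 3 := by
  have : m % 3 = 0 ∨ m % 3 = 1 ∨ m % 3 = 2 := by omega
  rcases this with h | h | h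
  · exact coloring_of_word m 3 _ (wd_good m 0 (by omega) (by omega) (by omega))
  · exact coloring_of_word m 3 _ (wd_good m 2 (by omega) (by omega) (by omega))
  · exact coloring_of_word m 3 _ (wd_good m 1 (by omega) (by omega) (by omega))

theorem c4_index : ssIndex (SimpleGraph.cycleGraph 4) = 4 := by
  have hmem : ∃ c, IsPColoring (SimpleGraph.cycleGraph (1 + 3)) IsSemistrongMatching c 4 := by
    refine coloring_of_word 1 4 (fun i => i.val) ⟨?_, ?_, ?_⟩ <;> decide
  apply le_antisymm
  · exact Nat.sInf_le hmem
  · refine le_csInf ⟨4, hmem⟩ ?_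
    intro k hk
    obtain ⟨w, h1, h2, h3⟩ := word_of_coloring 1 k hk
    have a0 := h1 0
    have a1 := h1 1
    have a2 := h1 2
    have a3 := h1 3
    have b0 : w 0 ≠ w 1 := h2 0
    have b1 : w 1 ≠ w 2 := h2 1
    have b2 : w 2 ≠ w 3 := h2 2
    have b3 : w 3 ≠ w 0 := h2 3
    have c0 : ¬ (w 0 = w 2 ∧ w 2 = w 0) := h3 0
    have c1 : ¬ (w 1 = w 3 ∧ w 3 = w 1) := h3 1
    omega

set_option maxRecDepth 10000 in
set_option synthInstance.maxSize 2000 in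
set_option synthInstance.maxHeartbeats 400000 in
theorem c7_aux : ∀ x0 x1 : Fin 3, x0 ≠ x1 → ∀ x2, x1 ≠ x2 → ∀ x3, x2 ≠ x3 → ∀ x4, x3 ≠ x4 →
    ¬ (x0 = x2 ∧ x2 = x4) → ∀ x5, x4 ≠ x5 → ¬ (x1 = x3 ∧ x3 = x5) → ¬ (x5 = x0 ∧ x0 = x2) →
    ¬ (x3 = x5 ∧ x5 = x0) → ∀ x6, x5 ≠ x6 → x6 ≠ x0 → ¬ (x2 = x4 ∧ x4 = x6) →
    ¬ (x4 = x6 ∧ x6 = x1) → ¬ (x6 = x1 ∧ x1 = x3) → False := by decide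

theorem c7_index : ssIndex (SimpleGraph.cycleGraph 7) = 4 := by
  have hmem : ∃ c, IsPColoring (SimpleGraph.cycleGraph (4 + 3)) IsSemistrongMatching c 4 := by
    refine coloring_of_word 4 4 (fun i => if i.val = 6 then 3 else i.val % 3) ⟨?_, ?_, ?_⟩ <;> decide
  apply le_antisymm
  · exact Nat.sInf_le hmem
  · refine le_csInf ⟨4, hmem⟩ ?_
    intro k hk
    obtain ⟨w, h1, h2, h3⟩ := word_of_coloring 4 k hk
    by_contra hk4
    have a : ∀ i, w i < 3 := fun i => by have := h1 i; omega
    have b0 : w 0 ≠ w 1 := h2 0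
    have b1 : w 1 ≠ w 2 := h2 1
    have b2 : w 2 ≠ w 3 := h2 2
    have b3 : w 3 ≠ w 4 := h2 3
    have b4 : w 4 ≠ w 5 := h2 4
    have b5 : w 5 ≠ w 6 := h2 5
    have b6 : w 6 ≠ w 0 := h2 6
    have c0 : ¬ (w 0 = w 2 ∧ w 2 = w 4) := h3 0
    have c1 : ¬ (w 1 = w 3 ∧ w 3 = w 5) := h3 1
    have c2 : ¬ (w 2 = w 4 ∧ w 4 = w 6) := h3 2
    have c3 : ¬ (w 3 = w 5 ∧ w 5 = w 0) := h3 3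
    have c4 : ¬ (w 4 = w 6 ∧ w 6 = w 1) := h3 4
    have c5 : ¬ (w 5 = w 0 ∧ w 0 = w 2) := h3 5
    have c6 : ¬ (w 6 = w 1 ∧ w 1 = w 3) := h3 6
    have inj : ∀ i j, (⟨w i, a i⟩ : Fin 3) = ⟨w j, a j⟩ → w i = w j :=
      fun i j h => congrArg Fin.val h
    exact c7_aux ⟨w 0, a 0⟩ ⟨w 1, a 1⟩ (fun h => b0 (inj _ _ h)) ⟨w 2, a 2⟩
      (fun h => b1 (inj _ _ h)) ⟨w 3, a 3⟩ (fun h => b2 (inj _ _ h)) ⟨w 4, a 4⟩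
      (fun h => b3 (inj _ _ h)) (fun h => c0 ⟨inj _ _ h.1, inj _ _ h.2⟩) ⟨w 5, a 5⟩
      (fun h => b4 (inj _ _ h)) (fun h => c1 ⟨inj _ _ h.1, inj _ _ h.2⟩)
      (fun h => c5 ⟨inj _ _ h.1, inj _ _ h.2⟩) (fun h => c3 ⟨inj _ _ h.1, inj _ _ h.2⟩)
      ⟨w 6, a 6⟩ (fun h => b5 (inj _ _ h)) (fun h => b6 (inj _ _ h))
      (fun h => c2 ⟨inj _ _ h.1, inj _ _ h.2⟩) (fun h => c4 ⟨inj _ _ h.1, inj _ _ h.2⟩)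
      (fun h => c6 ⟨inj _ _ h.1, inj _ _ h.2⟩)

/-- `f 0, …, f n` is a path in `G`. -/
def PathFn {V : Type} (G : SimpleGraph V) (n : ℕ) (f : ℕ → V) : Prop :=
  (∀ i ≤ n, ∀ j ≤ n, f i = f j → i = j) ∧ ∀ i < n, G.Adj (f i) (f (i + 1))

theorem pathFn_rev {V : Type} (G : SimpleGraph V) (n : ℕ) (f : ℕ → V) (h : PathFn G n f) :
    PathFn G n (fun i => f (n - i)) := by
  refine ⟨fun i hi j hj hij => ?_, fun i hi => ?_⟩
  · have := h.1 _ (by omega) _ (by omega) hij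
    omega
  · have := h.2 (n - (i + 1)) (by omega)
    rw [show n - (i + 1) + 1 = n - i by omega] at this
    exact this.symm

theorem pathFn_end {V : Type} (G : SimpleGraph V) (n : ℕ) (f : ℕ → V) (h : PathFn G n f)
    (hmax : ¬ ∃ g, PathFn G (n + 1) g) (x : V) (hx : G.Adj (f n) x) : ∃ j ≤ n, x = f j := by
  by_contra hcon
  push Not at hcon
  apply hmax
  refine ⟨fun i => if i ≤ n then f i else x, fun i hi j hj hij => ?_, fun i hi => ?_⟩
  · dsimp only at hij
    split_ifs at hij with h1 h2 h2
    · exact h.1 i h1 j h2 hij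
    · exact absurd hij.symm (hcon i h1)
    · exact absurd hij (hcon j h2)
    · omega
  · dsimp only
    rw [if_pos (by omega)]
    split_ifs with h1
    · exact h.2 i (by omega)
    · rw [show i = n by omega]; exact hx

theorem exists_max_path {V : Type} [Fintype V] (G : SimpleGraph V) (v : V) :
    ∃ n f, PathFn G n f ∧ ¬ ∃ g, PathFn G (n + 1) g := by
  by_contra hcon
  push Not at hcon
  have hall : ∀ n, ∃ f, PathFn G n f := by
    intro n
    induction n with
    | zero => exact ⟨fun _ => v, fun i hi j hj _ => by omega, fun i hi => by omega⟩
    | succ n ih => obtain ⟨f, hf⟩ := ih; exact hcon n f hf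
  obtain ⟨f, hf⟩ := hall (Fintype.card V)
  have : Function.Injective (fun i : Fin (Fintype.card V + 1) => f i.val) := by
    intro i j hij
    exact Fin.ext (hf.1 _ (by omega) _ (by omega) hij)
  have := Fintype.card_le_of_injective _ this
  simp at this

theorem deg_two {V : Type} [Fintype V] (G : SimpleGraph V) (v a b x : V) (h : natDeg G v ≤ 2)
    (ha : G.Adj v a) (hb : G.Adj v b) (hx : G.Adj v x) (hab : a ≠ b) : x = a ∨ x = b := by
  classical
  by_contra hcon
  push Not at hcon
  have hsub : (({a, b, x} : Finset V) : Set V) ⊆ G.neighborSet v := by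
    intro y hy
    simp at hy
    rcases hy with rfl | rfl | rfl <;> assumption
  have := Set.ncard_le_ncard hsub (Set.toFinite _)
  rw [Set.ncard_coe_finset, Finset.card_eq_three.2 ⟨a, b, x, hab, hcon.1.symm, hcon.2.symm, rfl⟩]
    at this
  unfold natDeg at h
  omega

theorem structure_two {V : Type} [Fintype V] (G : SimpleGraph V) (hG : G.Connected)
    (hd : ∀ v, natDeg G v ≤ 2) : ∃ n f, PathFn G n f ∧ (∀ x, ∃ j ≤ n, x = f j) ∧
      ∀ i j, i < j → j ≤ n → G.Adj (f i) (f j) → j = i + 1 ∨ (i = 0 ∧ j = n) := by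
  obtain ⟨v⟩ := hG.nonempty
  obtain ⟨n, f, hf, hmax⟩ := exists_max_path G v
  have hinner : ∀ i x, 0 < i → i < n → G.Adj (f i) x → x = f (i - 1) ∨ x = f (i + 1) := by
    intro i x h0 hn hx
    have h1 := hf.2 (i - 1) (by omega)
    rw [show i - 1 + 1 = i by omega] at h1
    refine deg_two G (f i) _ _ x (hd _) h1.symm (hf.2 i hn) hx ?_
    intro h
    have := hf.1 _ (by omega) _ (by omega) h
    omega
  have hcl : ∀ i ≤ n, ∀ x, G.Adj (f i) x → ∃ j ≤ n, x = f j := by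
    intro i hi x hx
    by_cases hn : i = n
    · subst hn; exact pathFn_end G _ f hf hmax x hx
    · by_cases h0 : i = 0
      · subst h0
        obtain ⟨j, hj, h⟩ := pathFn_end G n _ (pathFn_rev G n f hf) hmax x (by simpa using hx)
        exact ⟨n - j, by omega, h⟩
      · rcases hinner i x (by omega) (by omega) hx with h | h
        · exact ⟨_, by omega, h⟩
        · exact ⟨_, by omega, h⟩
  have hwalk : ∀ x y, G.Walk x y → (∃ j ≤ n, x = f j) → ∃ j ≤ n, y = f j := by
    intro x y p
    induction p with
    | nil => exact id
    | cons h p ih =>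
      rintro ⟨j, hj, rfl⟩
      exact ih (hcl j hj _ h)
  refine ⟨n, f, hf, fun x => ?_, fun i j hij hj ha => ?_⟩
  · obtain ⟨p⟩ := hG.preconnected (f 0) x
    exact hwalk _ _ p ⟨0, by omega, rfl⟩
  · by_cases h0 : i = 0
    · by_cases hn : j = n
      · exact Or.inr ⟨h0, hn⟩
      · rcases hinner j _ (by omega) (by omega) ha.symm with h | h
        · have := hf.1 _ (by omega) _ (by omega) h; omega
        · have := hf.1 _ (by omega) _ (by omega) h; omega
    · rcases hinner i _ (by omega) (by omega) ha with h | h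
      · have := hf.1 _ (by omega) _ (by omega) h; omega
      · have := hf.1 _ (by omega) _ (by omega) h; omega

theorem three_of_two {V : Type} [Fintype V] (G : SimpleGraph V) (hG : G.Connected)
    (hd : ∀ v, natDeg G v ≤ 2) (h4 : IsEmpty (G ≃g SimpleGraph.cycleGraph 4))
    (h7 : IsEmpty (G ≃g SimpleGraph.cycleGraph 7)) :
    ∃ c, IsPColoring G IsSemistrongMatching c 3 := by
  obtain ⟨n, f, hf, hsurj, hadj⟩ := structure_two G hG hd
  choose idx hidx hfi using hsurj
  have hinj : ∀ x y, idx x = idx y → x = y := fun x y h => by rw [hfi x, hfi y, h]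
  have hfidx : ∀ i ≤ n, idx (f i) = i := fun i hi => (hf.1 _ hi _ (hidx _) (hfi _)).symm
  have hadj' : ∀ x y, G.Adj x y → idx y = idx x + 1 ∨ idx x = idx y + 1 ∨
      (idx x = 0 ∧ idx y = n) ∨ (idx y = 0 ∧ idx x = n) := by
    intro x y h
    have hne : idx x ≠ idx y := fun h' => h.ne (hinj _ _ h')
    have h' := h
    rw [hfi x, hfi y] at h'
    rcases Nat.lt_or_gt_of_ne hne with hlt | hlt
    · have := hadj _ _ hlt (hidx y) h'
      omega
    · have := hadj _ _ hlt (hidx x) h'.symm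
      omega
  have hsucc : ∀ (m : ℕ) (i j : Fin (m + 3)), j.val = i.val + 1 → j = i + 1 := by
    intro m i j h
    have hj := j.2
    apply Fin.ext
    rw [Fin.val_add_one, if_neg, h]
    intro h'
    rw [h'] at h
    simp at h
    omega
  by_cases hc : 2 ≤ n ∧ G.Adj (f n) (f 0)
  · obtain ⟨hn, hc⟩ := hc
    obtain ⟨m, rfl⟩ : ∃ m, n = m + 2 := ⟨n - 2, by omega⟩
    let e : V ≃ Fin (m + 3) :=
      { toFun := fun x => ⟨idx x, by have := hidx x; omega⟩
        invFun := fun i => f i.val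
        left_inv := fun x => (hfi x).symm
        right_inv := fun i => Fin.ext (hfidx _ (by omega)) }
    have hev : ∀ x, (e x).val = idx x := fun x => rfl
    have hlast : ∀ (i j : Fin (m + 3)), i.val = m + 2 → j.val = 0 → j = i + 1 := by
      intro i j hi hj
      apply Fin.ext
      rw [Fin.val_add_one, if_pos, hj]
      apply Fin.ext; simpa using hi
    have hfwd : ∀ x y, G.Adj x y → (SimpleGraph.cycleGraph (m + 3)).Adj (e x) (e y) := by
      intro x y h
      rw [cyc_adj]
      rcases hadj' x y h with h | h | ⟨h, h'⟩ | ⟨h, h'⟩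
      · exact Or.inl (hsucc _ _ _ h)
      · exact Or.inr (hsucc _ _ _ h)
      · exact Or.inr (hlast _ _ h' h)
      · exact Or.inl (hlast _ _ h' h)
    have hstep : ∀ x y, e y = e x + 1 → G.Adj x y := by
      intro x y h
      have h' := congrArg Fin.val h
      rw [Fin.val_add_one] at h'
      rw [hfi x, hfi y]
      split_ifs at h' with hl
      · have hl' := congrArg Fin.val hl
        simp only [hev, Fin.val_last] at hl' h'
        rw [hl', h']; exact hc
      · simp only [hev] at h'
        rw [h']
        apply hf.2
        have := hidx y
        omega
    let iso : G ≃g SimpleGraph.cycleGraph (m + 3) :=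
      { toEquiv := e
        map_rel_iff' := by
          intro x y
          refine ⟨fun h => ?_, hfwd x y⟩
          rcases (cyc_adj m _ _).1 h with h | h
          · exact hstep _ _ h
          · exact (hstep _ _ h).symm }
    refine pullback G _ e e.injective hfwd 3 (cyc_three m ?_ ?_)
    · rintro rfl; exact h4.false iso
    · rintro rfl; exact h7.false iso
  · refine pullback G (SimpleGraph.cycleGraph (3 * n + 3))
      (fun x => ⟨idx x, by have := hidx x; omega⟩) ?_ ?_ 3 (cyc_three (3 * n) (by omega) (by omega))
    · intro x y h
      exact hinj x y (congrArg Fin.val h)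
    · intro x y h
      rw [cyc_adj]
      have hno : ∀ x y, G.Adj x y → idx x = 0 → idx y = n → idx y = idx x + 1 := by
        intro x y h h0 hn
        by_contra hcon
        apply hc
        have hne : idx x ≠ idx y := fun h' => h.ne (hinj _ _ h')
        refine ⟨by omega, ?_⟩
        rw [← h0, ← hn, ← hfi x, ← hfi y]
        exact h.symm
      rcases hadj' x y h with h' | h' | ⟨h1, h2⟩ | ⟨h1, h2⟩
      · exact Or.inl (hsucc _ _ _ h')
      · exact Or.inr (hsucc _ _ _ h')
      · exact Or.inl (hsucc _ _ _ (hno x y h h1 h2))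
      · exact Or.inr (hsucc _ _ _ (hno y x h.symm h1 h2))

/-- If `G` is a connected graph with maximum degree at most 2, other than `C_4` and `C_7`,
then `χ'_ss(G) ≤ 3`; moreover `χ'_ss(C_4) = χ'_ss(C_7) = 4`. -/
theorem ssIndex_max_degree_two :
    (∀ (V : Type) [Fintype V] (G : SimpleGraph V), G.Connected →
      (∀ v, natDeg G v ≤ 2) →
      IsEmpty (G ≃g SimpleGraph.cycleGraph 4) →
      IsEmpty (G ≃g SimpleGraph.cycleGraph 7) →
      ssIndex G ≤ 3) ∧
    ssIndex (SimpleGraph.cycleGraph 4) = 4 ∧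
    ssIndex (SimpleGraph.cycleGraph 7) = 4 := by
  refine ⟨?_, c4_index, c7_index⟩
  intro V _ G hG hd h4 h7
  exact Nat.sInf_le (three_of_two G hG hd h4 h7)


end SSE
end
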